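/- Let ω ∈ (π/2, π) and let q satisfy 0 < q < (√2/π)(π − ω) and q < (1/√2)·sin ω. Then the infimum η = inf{ L(a,f,g) : (a,f,g) ∈ 𝒞 } is finite and is attained: there exists (a,f,g) ∈ 𝒞 with L(a,f,g) = η. -/

import Mathlib

open Real MeasureTheory Set Filter

noncomputable section

/-- `h` is continuous on `[0,∞)` and absolutely continuous on every compact
subinterval of `(0,∞)` (encoded via the fundamental theorem of calculus,
with `deriv h` playing the role of the a.e. derivative `h'`). -/
def LocAC (h : ℝ → ℝ) : Prop :=
  ContinuousOn h (Set.Ici 0) ∧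
  ∀ s t : ℝ, 0 < s → s ≤ t →
    IntervalIntegrable (deriv h) MeasureTheory.volume s t ∧
    h t - h s = ∫ r in s..t, deriv h r

/-- `h` is locally absolutely continuous on `(0,∞)`, with derivative `deriv h`. -/
def LocACIoi (h : ℝ → ℝ) : Prop :=
  ∀ s t : ℝ, 0 < s → s ≤ t →
    IntervalIntegrable (deriv h) MeasureTheory.volume s t ∧
    h t - h s = ∫ r in s..t, deriv h r

/-- The density `𝓔₁`. -/
def calE1 (κ : ℝ) (a f : ℝ → ℝ) (r : ℝ) : ℝ :=
  2 * (2 * (deriv a r) ^ 2 + ((a r) ^ 2 - 1) ^ 2 / r ^ 2)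
    + (1 / 2) * (r ^ 2 * (deriv f r) ^ 2 + 2 * (a r) ^ 2 * Real.sin (f r) ^ 2)
    + 2 * κ * (a r) ^ 2 * Real.sin (f r) ^ 2
        * (2 * (deriv f r) ^ 2 + (a r) ^ 2 * Real.sin (f r) ^ 2 / r ^ 2)

/-- The density `𝓔₂`. -/
def calE2 (a g : ℝ → ℝ) (r : ℝ) : ℝ :=
  r ^ 2 * (deriv g r) ^ 2 + 2 * (a r) ^ 2 * (g r) ^ 2

/-- Finite energy: `E(a,f,g) = ∫₀^∞ (𝓔₁ + 𝓔₂) dr < ∞`. -/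
def FiniteEnergy (κ : ℝ) (a f g : ℝ → ℝ) : Prop :=
  MeasureTheory.IntegrableOn (fun r => calE1 κ a f r + calE2 a g r) (Set.Ioi 0)

/-- The action `L(a,f,g) = ∫₀^∞ (𝓔₁ - 𝓔₂) dr`. -/
def actionL (κ : ℝ) (a f g : ℝ → ℝ) : ℝ :=
  ∫ r in Set.Ioi (0 : ℝ), (calE1 κ a f r - calE2 a g r)

/-- The admissible class `𝒜`. -/
structure Admissible (κ ω q : ℝ) (a f g : ℝ → ℝ) : Prop where
  locAC_a : LocAC a
  locAC_f : LocAC f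
  locAC_g : LocAC g
  a_zero : a 0 = 1
  f_zero : f 0 = 0
  a_infty : Filter.Tendsto a Filter.atTop (nhds 0)
  f_infty : Filter.Tendsto f Filter.atTop (nhds (Real.pi - ω))
  g_infty : Filter.Tendsto g Filter.atTop (nhds q)
  finite_energy : FiniteEnergy κ a f g

/-- The constrained class `𝒞`: members of `𝒜` such that
`∫₀^∞ (r² g' G' + 2 a² g G) dr = 0` for every admissible test function `G`. -/
def Constrained (κ ω q : ℝ) (a f g : ℝ → ℝ) : Prop :=
  Admissible κ ω q a f g ∧
  ∀ G : ℝ → ℝ, LocACIoi G → Filter.Tendsto G Filter.atTop (nhds 0) →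
    MeasureTheory.IntegrableOn
      (fun r => r ^ 2 * (deriv G r) ^ 2 + 2 * (a r) ^ 2 * (G r) ^ 2) (Set.Ioi 0) →
    MeasureTheory.IntegrableOn
      (fun r => r ^ 2 * deriv g r * deriv G r + 2 * (a r) ^ 2 * g r * G r) (Set.Ioi 0) ∧
    ∫ r in Set.Ioi (0 : ℝ), (r ^ 2 * deriv g r * deriv G r + 2 * (a r) ^ 2 * g r * G r) = 0

open scoped Topology

/-- `H` is locally integrable on `(0,∞)` and `h` is a primitive of it there. -/
def IsPrimitive (h H : ℝ → ℝ) : Prop :=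
  ∀ s t : ℝ, 0 < s → s ≤ t → IntervalIntegrable H volume s t ∧ h t - h s = ∫ r in s..t, H r

lemma LocACIoi.isPrimitive {h : ℝ → ℝ} (hh : LocACIoi h) : IsPrimitive h (deriv h) := hh

lemma LocAC.isPrimitive {h : ℝ → ℝ} (hh : LocAC h) : IsPrimitive h (deriv h) := hh.2

namespace IsPrimitive

variable {h H k K : ℝ → ℝ}

lemma ae_hasDerivAt (hh : IsPrimitive h H) :
    ∀ᵐ r ∂(volume.restrict (Ioi (0 : ℝ))), HasDerivAt h (H r) r := by
  rw [ae_restrict_iff' measurableSet_Ioi]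
  have key : ∀ n : ℕ, ∀ᵐ x : ℝ, x ∈ uIcc (1 / ((n : ℝ) + 1)) (n + 1) →
      ∀ c ∈ uIcc (1 / ((n : ℝ) + 1)) (n + 1), HasDerivAt (fun x => ∫ t in c..x, H t) (H x) x := by
    intro n
    have h1 : (1 : ℝ) / ((n : ℝ) + 1) ≤ n + 1 := by
      rw [div_le_iff₀ (by positivity)]; nlinarith [Nat.cast_nonneg (α := ℝ) n]
    exact ((hh _ _ (by positivity) h1).1).ae_hasDerivAt_integral
  filter_upwards [ae_all_iff.2 key] with x hx hx0
  have hx0 : 0 < x := hx0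
  obtain ⟨n, hn⟩ := exists_nat_gt (max x (1 / x))
  have hn1 : x < n + 1 := by linarith [le_max_left x (1 / x)]
  have hn2 : 1 / ((n : ℝ) + 1) < x := by
    rw [div_lt_iff₀ (by positivity)]
    have : 1 / x < n + 1 := by linarith [le_max_right x (1 / x)]
    rw [div_lt_iff₀ hx0] at this; linarith
  have hle : 1 / ((n : ℝ) + 1) ≤ n + 1 := by linarith
  have hd := hx n (by rw [uIcc_of_le hle]; exact ⟨hn2.le, hn1.le⟩) _ left_mem_uIcc
  refine (hd.const_add (h (1 / ((n : ℝ) + 1)))).congr_of_eventuallyEq ?_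
  filter_upwards [lt_mem_nhds hn2] with y hy
  rw [← (hh _ y (by positivity) hy.le).2]; ring

lemma deriv_ae_eq (hh : IsPrimitive h H) : deriv h =ᵐ[volume.restrict (Ioi (0 : ℝ))] H := by
  filter_upwards [hh.ae_hasDerivAt] with r hr using hr.deriv

lemma ae_eq_restrict_uIoc {s t : ℝ} (hs : 0 < s) (hst : s ≤ t)
    (hHK : H =ᵐ[volume.restrict (Ioi (0 : ℝ))] K) : H =ᵐ[volume.restrict (uIoc s t)] K :=
  ae_restrict_of_ae_restrict_of_subset
    (by rw [uIoc_of_le hst]; exact fun r hr => hs.trans hr.1) hHK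

lemma congr_ae (hh : IsPrimitive h H) (hHK : H =ᵐ[volume.restrict (Ioi (0 : ℝ))] K) :
    IsPrimitive h K := fun s t hs hst => by
  have h1 := ae_eq_restrict_uIoc hs hst hHK
  refine ⟨(hh s t hs hst).1.congr_ae h1, ?_⟩
  rw [(hh s t hs hst).2]
  exact intervalIntegral.integral_congr_ae_restrict h1

lemma locACIoi (hh : IsPrimitive h H) : LocACIoi h := hh.congr_ae hh.deriv_ae_eq.symm

lemma congr (hh : IsPrimitive h H) (hk : ∀ r, 0 < r → h r = k r) : IsPrimitive k H :=
  fun s t hs hst => by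
    rw [← hk s hs, ← hk t (hs.trans_le hst)]; exact hh s t hs hst

lemma sub (hh : IsPrimitive h H) (hk : IsPrimitive k K) :
    IsPrimitive (fun r => h r - k r) (fun r => H r - K r) := fun s t hs hst => by
  obtain ⟨h1, h2⟩ := hh s t hs hst
  obtain ⟨h3, h4⟩ := hk s t hs hst
  refine ⟨h1.sub h3, ?_⟩
  rw [intervalIntegral.integral_sub h1 h3, ← h2, ← h4]; ring

lemma const_mul (c : ℝ) (hh : IsPrimitive h H) :
    IsPrimitive (fun r => c * h r) (fun r => c * H r) := fun s t hs hst => by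
  obtain ⟨h1, h2⟩ := hh s t hs hst
  refine ⟨h1.const_mul c, ?_⟩
  rw [intervalIntegral.integral_const_mul, ← h2]; ring

lemma continuousOn (hh : IsPrimitive h H) : ContinuousOn h (Ioi 0) := by
  intro x hx
  have hx : 0 < x := hx
  have h1 := (hh (x / 2) (x + 1) (by positivity) (by linarith)).1
  have h2 := (intervalIntegral.continuousOn_primitive_interval' h1 left_mem_uIcc).const_add
    (b := h (x / 2))
  have h3 : ContinuousOn h (Icc (x / 2) (x + 1)) := by
    rw [uIcc_of_le (by linarith)] at h2
    refine h2.congr fun y hy => ?_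
    simp only [← (hh (x / 2) y (by positivity) hy.1).2]; ring
  exact (h3.continuousAt (Icc_mem_nhds (by linarith) (by linarith))).continuousWithinAt

lemma comp (hh : IsPrimitive h H) {φ φ' : ℝ → ℝ} {C : NNReal} (hφ : LipschitzWith C φ)
    (hφ' : ∀ x, HasDerivAt φ (φ' x) x) (hc : Continuous φ') :
    IsPrimitive (fun r => φ (h r)) (fun r => φ' (h r) * H r) := fun s t hs hst => by
  obtain ⟨h1, -⟩ := hh s t hs hst
  have hcont : ContinuousOn h (uIcc s t) :=
    hh.continuousOn.mono (by rw [uIcc_of_le hst]; exact fun r hr => hs.trans_le hr.1)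
  set F : ℝ → ℝ := fun x => h s + ∫ r in s..x, H r with hF
  have hFh : ∀ x ∈ uIcc s t, F x = h x := fun x hx => by
    rw [uIcc_of_le hst] at hx
    simp only [hF]; rw [← (hh s x hs hx.1).2]; ring
  have hAC : AbsolutelyContinuousOnInterval F s t := by
    refine (h1.absolutelyContinuousOnInterval_intervalIntegral (c := s) left_mem_uIcc).congr' ?_
    exact Eventually.of_forall fun E => by simp [hF]
  have hAC' : AbsolutelyContinuousOnInterval (fun x => φ (F x)) s t := by
    refine squeeze_zero (fun E => Finset.sum_nonneg fun i _ => dist_nonneg) (fun E => ?_)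
      (by simpa using Tendsto.const_mul (C : ℝ) hAC)
    rw [Finset.mul_sum]
    exact Finset.sum_le_sum fun i _ => hφ.dist_le_mul _ _
  have hd : ∀ᵐ x, x ∈ uIoc s t → deriv (fun x => φ (F x)) x = φ' (h x) * H x := by
    filter_upwards [h1.ae_hasDerivAt_integral] with x hx hxm
    have hxm' := uIoc_subset_uIcc hxm
    have h3 : HasDerivAt F (H x) x := (hx hxm' s left_mem_uIcc).const_add _
    rw [← hFh x hxm']
    exact ((hφ' (F x)).comp x h3).deriv
  refine ⟨h1.continuousOn_mul (hc.comp_continuousOn hcont), ?_⟩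
  rw [← intervalIntegral.integral_congr_ae hd, hAC'.integral_deriv_eq_sub,
    hFh t right_mem_uIcc, hFh s left_mem_uIcc]

lemma sin (hh : IsPrimitive h H) :
    IsPrimitive (fun r => Real.sin (h r)) (fun r => Real.cos (h r) * H r) :=
  hh.comp Real.lipschitzWith_sin Real.hasDerivAt_sin Real.continuous_cos

lemma cos (hh : IsPrimitive h H) :
    IsPrimitive (fun r => Real.cos (h r)) (fun r => -Real.sin (h r) * H r) :=
  hh.comp Real.lipschitzWith_cos Real.hasDerivAt_cos Real.continuous_sin.neg

lemma of_hasDerivAt (hd : ∀ r, 0 < r → HasDerivAt h (H r) r) (hc : ContinuousOn H (Ioi 0)) :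
    IsPrimitive h H := fun s t hs hst => by
  have hsub : uIcc s t ⊆ Ioi 0 := by
    rw [uIcc_of_le hst]; exact fun r hr => hs.trans_le hr.1
  have hi : IntervalIntegrable H volume s t := (hc.mono hsub).intervalIntegrable
  exact ⟨hi, (intervalIntegral.integral_eq_sub_of_hasDerivAt (fun r hr => hd r (hsub hr)) hi).symm⟩

end IsPrimitive

section SquareIntegrable

variable {α : Type*} [MeasurableSpace α] {μ : Measure α}

lemma inner_toLp_eq_integral {x y : α → ℝ} (hx : MemLp x 2 μ) (hy : MemLp y 2 μ) :
    inner ℝ (hx.toLp x) (hy.toLp y) = ∫ a, x a * y a ∂μ := by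
  rw [L2.inner_def]
  refine integral_congr_ae ?_
  filter_upwards [hx.coeFn_toLp, hy.coeFn_toLp] with a h1 h2
  simp [h1, h2, mul_comm]

lemma norm_toLp_sq_eq_integral {x : α → ℝ} (hx : MemLp x 2 μ) :
    ‖hx.toLp x‖ ^ 2 = ∫ a, x a ^ 2 ∂μ := by
  rw [← real_inner_self_eq_norm_sq, inner_toLp_eq_integral]
  simp [sq]

lemma sq_integral_mul_le {x y : α → ℝ} (hx : MemLp x 2 μ) (hy : MemLp y 2 μ) :
    (∫ a, x a * y a ∂μ) ^ 2 ≤ (∫ a, x a ^ 2 ∂μ) * ∫ a, y a ^ 2 ∂μ := by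
  rw [← inner_toLp_eq_integral hx hy, ← norm_toLp_sq_eq_integral hx,
    ← norm_toLp_sq_eq_integral hy, ← mul_pow, sq_le_sq, abs_mul, abs_norm, abs_norm]
  exact abs_real_inner_le_norm _ _

/-- Bounded weak convergence of a sequence in `L²(μ)`. -/
structure WeakTendsto (μ : Measure α) (x : ℕ → α → ℝ) (X : α → ℝ) : Prop where
  memLp : ∀ n, MemLp (x n) 2 μ
  memLp_limit : MemLp X 2 μ
  bounded : ∃ C, ∀ n, ∫ a, x n a ^ 2 ∂μ ≤ C
  tendsto : ∀ y, MemLp y 2 μ → Tendsto (fun n => ∫ a, x n a * y a ∂μ) atTop (𝓝 (∫ a, X a * y a ∂μ))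

lemma exists_weakTendsto_subseq [TopologicalSpace.SeparableSpace (Lp ℝ 2 μ)] {x : ℕ → α → ℝ}
    (hx : ∀ n, MemLp (x n) 2 μ) {C : ℝ} (hC : ∀ n, ∫ a, x n a ^ 2 ∂μ ≤ C) :
    ∃ φ : ℕ → ℕ, StrictMono φ ∧ ∃ X, WeakTendsto μ (fun n => x (φ n)) X := by
  let ξ : ℕ → WeakDual ℝ (Lp ℝ 2 μ) := fun n =>
    StrongDual.toWeakDual (InnerProductSpace.toDual ℝ (Lp ℝ 2 μ) ((hx n).toLp (x n)))
  have hξ : ∀ n, ξ n ∈ WeakDual.toStrongDual ⁻¹' Metric.closedBall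
      (0 : StrongDual ℝ (Lp ℝ 2 μ)) (√C) := fun n => by
    rw [mem_preimage, mem_closedBall_zero_iff]
    refine (LinearIsometryEquiv.norm_map (InnerProductSpace.toDual ℝ (Lp ℝ 2 μ)) _).le.trans ?_
    exact Real.le_sqrt_of_sq_le ((norm_toLp_sq_eq_integral (hx n)).le.trans (hC n))
  obtain ⟨ℓ, -, φ, hφ, hlim⟩ := WeakDual.isSeqCompact_closedBall ℝ (Lp ℝ 2 μ) 0 (√C) hξ
  let z : Lp ℝ 2 μ := (InnerProductSpace.toDual ℝ (Lp ℝ 2 μ)).symm (WeakDual.toStrongDual ℓ)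
  refine ⟨φ, hφ, z, fun n => hx _, Lp.memLp z, ⟨C, fun n => hC _⟩, fun y hy => ?_⟩
  have h1 := ((WeakDual.eval_continuous (hy.toLp y)).tendsto ℓ).comp hlim
  have h2 : ∀ n, ξ n (hy.toLp y) = ∫ a, x n a * y a ∂μ := fun n => by
    rw [← inner_toLp_eq_integral (hx n) hy]
    rfl
  have h3 : ℓ (hy.toLp y) = ∫ a, z a * y a ∂μ := by
    have : inner ℝ z (hy.toLp y) = ℓ (hy.toLp y) :=
      InnerProductSpace.toDual_symm_apply
    rw [← this, ← inner_toLp_eq_integral (Lp.memLp z) hy, Lp.toLp_coeFn]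
  rw [← h3]
  exact h1.congr fun n => h2 (φ n)

namespace WeakTendsto

variable {x : ℕ → α → ℝ} {X : α → ℝ}

lemma comp_subseq (h : WeakTendsto μ x X) {φ : ℕ → ℕ} (hφ : StrictMono φ) :
    WeakTendsto μ (fun n => x (φ n)) X :=
  ⟨fun _ => h.memLp _, h.memLp_limit, h.bounded.imp fun _ hC _ => hC _,
    fun y hy => (h.tendsto y hy).comp hφ.tendsto_atTop⟩

lemma restrict (h : WeakTendsto μ x X) {s : Set α} (hs : MeasurableSet s) :
    WeakTendsto (μ.restrict s) x X := by
  refine ⟨fun n => (h.memLp n).restrict s, h.memLp_limit.restrict s, ?_, fun y hy => ?_⟩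
  · obtain ⟨C, hC⟩ := h.bounded
    exact ⟨C, fun n => (setIntegral_le_integral (h.memLp n).integrable_sq
      (Eventually.of_forall fun a => sq_nonneg _)).trans (hC n)⟩
  · have hy' : MemLp (s.indicator y) 2 μ := (memLp_indicator_iff_restrict hs).2 hy
    have key : ∀ z : α → ℝ, ∫ a in s, z a * y a ∂μ = ∫ a, z a * s.indicator y a ∂μ := fun z => by
      rw [← integral_indicator hs]
      refine integral_congr_ae (Eventually.of_forall fun a => ?_)
      by_cases ha : a ∈ s <;> simp [ha]
    simp only [key]
    exact h.tendsto _ hy'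

lemma tendsto_mul_bounded (h : WeakTendsto μ x X) {c : ℕ → α → ℝ} {c' : α → ℝ} {B : ℝ}
    (hcm : ∀ n, AEStronglyMeasurable (c n) μ) (hB : ∀ n, ∀ᵐ a ∂μ, |c n a| ≤ B)
    (hc : ∀ᵐ a ∂μ, Tendsto (fun n => c n a) atTop (𝓝 (c' a))) {y : α → ℝ} (hy : MemLp y 2 μ) :
    Tendsto (fun n => ∫ a, x n a * (c n a * y a) ∂μ) atTop (𝓝 (∫ a, X a * (c' a * y a) ∂μ)) := by
  have hcm' : AEStronglyMeasurable c' μ := aestronglyMeasurable_of_tendsto_ae atTop hcm hc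
  have hB' : ∀ᵐ a ∂μ, |c' a| ≤ B := by
    filter_upwards [ae_all_iff.2 hB, hc] with a h1 h2
    exact le_of_tendsto h2.abs (Eventually.of_forall h1)
  have hcy : ∀ n, MemLp (fun a => c n a * y a) 2 μ := fun n =>
    (hy.const_mul B).mono ((hcm n).mul hy.1) (by
      filter_upwards [hB n] with a ha
      rw [norm_mul, norm_mul, Real.norm_eq_abs, Real.norm_eq_abs B]
      exact mul_le_mul_of_nonneg_right (ha.trans (le_abs_self B)) (norm_nonneg _))
  have hcy' : MemLp (fun a => c' a * y a) 2 μ :=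
    (hy.const_mul B).mono (hcm'.mul hy.1) (by
      filter_upwards [hB'] with a ha
      rw [norm_mul, norm_mul, Real.norm_eq_abs, Real.norm_eq_abs B]
      exact mul_le_mul_of_nonneg_right (ha.trans (le_abs_self B)) (norm_nonneg _))
  have hd : ∀ n, MemLp (fun a => c n a * y a - c' a * y a) 2 μ := fun n => (hcy n).sub hcy'
  have hd0 : Tendsto (fun n => ∫ a, (c n a * y a - c' a * y a) ^ 2 ∂μ) atTop (𝓝 0) := by
    have := tendsto_integral_of_dominated_convergence (μ := μ)
      (F := fun n a => (c n a * y a - c' a * y a) ^ 2) (f := fun _ => 0)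
      (fun a => 4 * (B * y a) ^ 2) (fun n => (hd n).1.pow 2)
      ((hy.const_mul B).integrable_sq.const_mul 4) (fun n => by
        filter_upwards [hB n, hB'] with a h1 h2
        rw [Real.norm_eq_abs, abs_of_nonneg (sq_nonneg _)]
        have h3 : |c n a - c' a| ≤ 2 * B := (abs_sub _ _).trans (by linarith)
        have h4 : (c n a - c' a) ^ 2 ≤ (2 * B) ^ 2 := by
          rw [← sq_abs]; exact pow_le_pow_left₀ (abs_nonneg _) h3 2
        nlinarith [mul_le_mul_of_nonneg_right h4 (sq_nonneg (y a))]) (by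
        filter_upwards [hc] with a ha
        have := ((ha.mul_const (y a)).sub_const (c' a * y a)).pow 2
        simpa using this)
    simpa using this
  obtain ⟨C, hC⟩ := h.bounded
  have hsmall : Tendsto (fun n => ∫ a, x n a * (c n a * y a - c' a * y a) ∂μ) atTop (𝓝 0) := by
    have h1 : Tendsto (fun n => √(C * ∫ a, (c n a * y a - c' a * y a) ^ 2 ∂μ)) atTop (𝓝 0) := by
      simpa using (hd0.const_mul C).sqrt
    refine squeeze_zero_norm (fun n => ?_) h1
    refine Real.le_sqrt_of_sq_le ?_
    rw [Real.norm_eq_abs, sq_abs]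
    exact (sq_integral_mul_le (h.memLp n) (hd n)).trans
      (mul_le_mul_of_nonneg_right (hC n) (integral_nonneg fun a => sq_nonneg _))
  have := hsmall.add (h.tendsto _ hcy')
  rw [zero_add] at this
  refine this.congr fun n => ?_
  have i1 : Integrable (fun a => x n a * (c n a * y a - c' a * y a)) μ :=
    (h.memLp n).integrable_mul (hd n)
  have i2 : Integrable (fun a => x n a * (c' a * y a)) μ := (h.memLp n).integrable_mul hcy'
  rw [← integral_add i1 i2]
  exact integral_congr_ae (Eventually.of_forall fun a => by ring)

/-- The tangent-line minorants of `∫ c x²` converge to its value at the weak limit. -/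
lemma tendsto_tangent (h : WeakTendsto μ x X) {c : ℕ → α → ℝ} {c' : α → ℝ} {B : ℝ}
    (hcm : ∀ n, AEStronglyMeasurable (c n) μ) (hB : ∀ n, ∀ᵐ a ∂μ, |c n a| ≤ B)
    (hc : ∀ᵐ a ∂μ, Tendsto (fun n => c n a) atTop (𝓝 (c' a))) :
    (∀ n, Integrable (fun a => c n a * (2 * x n a * X a - X a ^ 2)) μ) ∧
    Tendsto (fun n => ∫ a, c n a * (2 * x n a * X a - X a ^ 2) ∂μ) atTop
      (𝓝 (∫ a, c' a * X a ^ 2 ∂μ)) := by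
  have h1 := h.tendsto_mul_bounded hcm hB hc h.memLp_limit
  have h2 := (show WeakTendsto μ (fun _ => X) X from ⟨fun _ => h.memLp_limit, h.memLp_limit,
    ⟨_, fun _ => le_rfl⟩, fun y hy => tendsto_const_nhds⟩).tendsto_mul_bounded hcm hB hc
      h.memLp_limit
  have hi : ∀ n, ∀ y, MemLp y 2 μ → Integrable (fun a => y a * (c n a * X a)) μ := fun n y hy => by
    have : Integrable (fun a => c n a * (y a * X a)) μ :=
      (hy.integrable_mul h.memLp_limit).bdd_mul (hcm n) (hB n)
    exact this.congr (Eventually.of_forall fun a => by ring)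
  have h3 := (h1.const_mul 2).sub h2
  have e : ∀ n, (fun a => c n a * (2 * x n a * X a - X a ^ 2)) =
      fun a => 2 * (x n a * (c n a * X a)) - X a * (c n a * X a) := fun n => by
    funext a; ring
  have hx := fun n => hi n _ (h.memLp n)
  have hX := fun n => hi n _ h.memLp_limit
  refine ⟨fun n => ?_, ?_⟩
  · rw [e]; exact ((hx n).const_mul 2).sub (hX n)
  · have e2 : (∫ a, c' a * X a ^ 2 ∂μ) = 2 * ∫ a, X a * (c' a * X a) ∂μ
        - ∫ a, X a * (c' a * X a) ∂μ := by
      rw [two_mul, add_sub_cancel_right]; congr 1; funext a; ring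
    rw [e2]
    refine h3.congr fun n => ?_
    rw [e, integral_sub ((hx n).const_mul 2) (hX n), integral_const_mul]

end WeakTendsto

end SquareIntegrable

notation "μ₊" => Measure.restrict (volume : Measure ℝ) (Ioi (0 : ℝ))

section HalfLine

variable {A u : ℝ → ℝ}

lemma restrict_halfLine {s : Set ℝ} (hs : s ⊆ Ioi 0) (hm : MeasurableSet s) :
    μ₊.restrict s = volume.restrict s := by
  rw [Measure.restrict_restrict hm, inter_eq_left.2 hs]

lemma memLp_restrict_of_halfLine (hA : MemLp A 2 μ₊) {s : Set ℝ} (hs : s ⊆ Ioi 0) :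
    MemLp A 2 (volume.restrict s) :=
  hA.mono_measure (Measure.restrict_mono_set _ hs)

lemma integrableOn_sq_of_halfLine (hA : MemLp A 2 μ₊) {s : Set ℝ} (hs : s ⊆ Ioi 0) :
    IntegrableOn (fun r => A r ^ 2) s :=
  (memLp_restrict_of_halfLine hA hs).integrable_sq

lemma setIntegral_sq_le_halfLine (hA : MemLp A 2 μ₊) {s : Set ℝ} (hs : s ⊆ Ioi 0) :
    ∫ r in s, A r ^ 2 ≤ ∫ r in Ioi (0 : ℝ), A r ^ 2 :=
  setIntegral_mono_set (integrableOn_sq_of_halfLine hA subset_rfl)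
    (Eventually.of_forall fun _ => sq_nonneg _) (LE.le.eventuallyLE hs)

lemma intervalIntegrable_of_halfLine (hA : MemLp A 2 μ₊) {s t : ℝ} (hs : 0 ≤ s) (hst : s ≤ t) :
    IntervalIntegrable A volume s t := by
  rw [intervalIntegrable_iff_integrableOn_Ioc_of_le hst]
  exact (memLp_restrict_of_halfLine hA fun r hr => hs.trans_lt hr.1).integrable (by norm_num)

lemma sq_intervalIntegral_le {s t : ℝ} (hst : s ≤ t) (hA : MemLp A 2 (volume.restrict (Ioc s t))) :
    (∫ r in s..t, A r) ^ 2 ≤ (t - s) * ∫ r in Ioc s t, A r ^ 2 := by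
  rw [intervalIntegral.integral_of_le hst]
  have := sq_integral_mul_le (memLp_const (1 : ℝ)) hA
  simpa [hst] using this

lemma isPrimitive_integral_zero (hA : MemLp A 2 μ₊) (c : ℝ) :
    IsPrimitive (fun t => c + ∫ r in (0 : ℝ)..t, A r) A := fun s t hs hst => by
  refine ⟨intervalIntegrable_of_halfLine hA hs.le hst, ?_⟩
  rw [← intervalIntegral.integral_interval_sub_left
    (intervalIntegrable_of_halfLine hA le_rfl (hs.le.trans hst))
    (intervalIntegrable_of_halfLine hA le_rfl hs.le)]
  ring

lemma continuousOn_integral_zero (hA : MemLp A 2 μ₊) (c : ℝ) :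
    ContinuousOn (fun t => c + ∫ r in (0 : ℝ)..t, A r) (Ici 0) := by
  intro x hx
  have hx : 0 ≤ x := hx
  have h1 := (intervalIntegral.continuousOn_primitive_interval'
    (intervalIntegrable_of_halfLine hA le_rfl (by linarith : (0 : ℝ) ≤ x + 1))
    left_mem_uIcc).const_add (b := c)
  rw [uIcc_of_le (by linarith)] at h1
  refine (h1 x ⟨hx, by linarith⟩).mono_of_mem_nhdsWithin ?_
  rw [← Ici_inter_Iic]
  exact inter_mem_nhdsWithin _ (Iic_mem_nhds (by linarith))

lemma IsPrimitive.eq_integral_zero {h : ℝ → ℝ} (hh : IsPrimitive h A) (hA : MemLp A 2 μ₊)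
    (hc : ContinuousOn h (Ici 0)) {t : ℝ} (ht : 0 < t) : h t = h 0 + ∫ r in (0 : ℝ)..t, A r := by
  have h1 : Tendsto (fun s => h s - (0 + ∫ r in (0 : ℝ)..s, A r)) (𝓝[>] 0)
      (𝓝 (h 0 - (0 + ∫ r in (0 : ℝ)..(0 : ℝ), A r))) :=
    ((hc 0 self_mem_Ici).mono Ioi_subset_Ici_self).tendsto.sub
      ((continuousOn_integral_zero hA 0 0 self_mem_Ici).mono Ioi_subset_Ici_self).tendsto
  have h2 : Tendsto (fun s => h s - (0 + ∫ r in (0 : ℝ)..s, A r)) (𝓝[>] 0)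
      (𝓝 (h t - (0 + ∫ r in (0 : ℝ)..t, A r))) := by
    refine tendsto_const_nhds.congr' ?_
    filter_upwards [Ioo_mem_nhdsGT ht] with s hs
    have e1 := (hh s t hs.1 hs.2.le).2
    have e2 := (isPrimitive_integral_zero hA 0 s t hs.1 hs.2.le).2
    linarith
  have := tendsto_nhds_unique h1 h2
  simp at this
  linarith

lemma integrableOn_inv_sq_Ioi {t : ℝ} (ht : 0 < t) :
    IntegrableOn (fun r : ℝ => r⁻¹ ^ 2) (Ioi t) ∧ ∫ r in Ioi t, r⁻¹ ^ 2 = t⁻¹ := by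
  have e : EqOn (fun r : ℝ => r⁻¹ ^ 2) (fun r => r ^ (-2 : ℝ)) (Ioi t) := fun r hr => by
    have : 0 < r := ht.trans hr
    simp only
    rw [Real.rpow_neg this.le, inv_pow]; norm_num
  refine ⟨(integrableOn_Ioi_rpow_of_lt (by norm_num : (-2 : ℝ) < -1) ht).congr_fun e.symm
    measurableSet_Ioi, ?_⟩
  rw [setIntegral_congr_fun measurableSet_Ioi e,
    integral_Ioi_rpow_of_lt (by norm_num : (-2 : ℝ) < -1) ht]
  norm_num
  rw [Real.rpow_neg_one]

lemma memLp_inv_Ioi {t : ℝ} (ht : 0 < t) :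
    MemLp (fun r : ℝ => r⁻¹) 2 (volume.restrict (Ioi t)) :=
  (memLp_two_iff_integrable_sq measurable_inv.aestronglyMeasurable).2 (integrableOn_inv_sq_Ioi ht).1

lemma integrableOn_div_Ioi (hu : MemLp u 2 μ₊) {t : ℝ} (ht : 0 < t) :
    IntegrableOn (fun r => u r / r) (Ioi t) := by
  simp only [div_eq_mul_inv]
  exact (memLp_restrict_of_halfLine hu (Ioi_subset_Ioi ht.le)).integrable_mul (memLp_inv_Ioi ht)

lemma sq_integral_tail_le (hu : MemLp u 2 μ₊) {t : ℝ} (ht : 0 < t) :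
    (∫ r in Ioi t, u r / r) ^ 2 ≤ t⁻¹ * ∫ r in Ioi (0 : ℝ), u r ^ 2 := by
  have hs := Ioi_subset_Ioi ht.le
  have := sq_integral_mul_le (memLp_restrict_of_halfLine hu hs) (memLp_inv_Ioi ht)
  rw [(integrableOn_inv_sq_Ioi ht).2] at this
  simp only [div_eq_mul_inv]
  rw [mul_comm]
  exact this.trans (mul_le_mul_of_nonneg_right (setIntegral_sq_le_halfLine hu hs)
    (inv_nonneg.2 ht.le))

lemma isPrimitive_tail (hu : MemLp u 2 μ₊) (c : ℝ) :
    IsPrimitive (fun t => c - ∫ r in Ioi t, u r / r) (fun r => u r / r) := fun s t hs hst => by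
  have hi := integrableOn_div_Ioi hu hs
  have h1 : IntervalIntegrable (fun r => u r / r) volume s t :=
    (intervalIntegrable_iff_integrableOn_Ioc_of_le hst).2 (hi.mono_set Ioc_subset_Ioi_self)
  refine ⟨h1, ?_⟩
  beta_reduce
  rw [intervalIntegral.integral_of_le hst, ← Ioc_union_Ioi_eq_Ioi hst,
    setIntegral_union (Ioc_disjoint_Ioi le_rfl) measurableSet_Ioi (hi.mono_set Ioc_subset_Ioi_self)
      (hi.mono_set (Ioi_subset_Ioi hst))]
  ring

lemma tendsto_tail (hu : MemLp u 2 μ₊) (c : ℝ) :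
    Tendsto (fun t => c - ∫ r in Ioi t, u r / r) atTop (𝓝 c) := by
  have h1 : Tendsto (fun t : ℝ => ∫ r in Ioi t, u r / r) atTop (𝓝 0) := by
    refine squeeze_zero_norm' (a := fun t : ℝ => √(t⁻¹ * ∫ r in Ioi (0 : ℝ), u r ^ 2)) ?_ ?_
    · filter_upwards [eventually_gt_atTop 0] with t ht
      refine Real.le_sqrt_of_sq_le ?_
      rw [Real.norm_eq_abs, sq_abs]
      exact sq_integral_tail_le hu ht
    · simpa using (tendsto_inv_atTop_zero.mul_const (∫ r in Ioi (0 : ℝ), u r ^ 2)).sqrt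
  simpa using h1.const_sub c

lemma IsPrimitive.eq_sub_tail {h H : ℝ → ℝ} (hh : IsPrimitive h H)
    (hH : MemLp (fun r => r * H r) 2 μ₊) {l : ℝ} (hl : Tendsto h atTop (𝓝 l)) {t : ℝ}
    (ht : 0 < t) : h t = l - ∫ r in Ioi t, r * H r / r := by
  have h1 : Tendsto (fun s => h s - (l - ∫ r in Ioi s, r * H r / r)) atTop (𝓝 (l - l)) :=
    hl.sub (tendsto_tail hH l)
  have h2 : Tendsto (fun s => h s - (l - ∫ r in Ioi s, r * H r / r)) atTop
      (𝓝 (h t - (l - ∫ r in Ioi t, r * H r / r))) := by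
    refine tendsto_const_nhds.congr' ?_
    filter_upwards [eventually_ge_atTop t] with s hs
    have e1 := (hh t s ht hs).2
    have e2 := (isPrimitive_tail hH l t s ht hs).2
    have e3 : ∫ r in t..s, r * H r / r = ∫ r in t..s, H r := by
      refine intervalIntegral.integral_congr fun r hr => ?_
      rw [uIcc_of_le hs] at hr
      have : r ≠ 0 := (ht.trans_le hr.1).ne'
      field_simp
    rw [e3] at e2
    linarith
  have := tendsto_nhds_unique h1 h2
  linarith

lemma IsPrimitive.sq_sub_limit_le {h H : ℝ → ℝ} (hh : IsPrimitive h H)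
    (hH : MemLp (fun r => r * H r) 2 μ₊) {l : ℝ} (hl : Tendsto h atTop (𝓝 l)) {t : ℝ}
    (ht : 0 < t) : (h t - l) ^ 2 ≤ t⁻¹ * ∫ r in Ioi (0 : ℝ), (r * H r) ^ 2 := by
  rw [hh.eq_sub_tail hH hl ht, sub_sub_cancel_left, neg_sq]
  exact sq_integral_tail_le hH ht

lemma IsPrimitive.sq_sub_zero_le {h : ℝ → ℝ} (hh : IsPrimitive h A) (hA : MemLp A 2 μ₊)
    (hc : ContinuousOn h (Ici 0)) {t : ℝ} (ht : 0 < t) :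
    (h t - h 0) ^ 2 ≤ t * ∫ r in Ioi (0 : ℝ), A r ^ 2 := by
  rw [hh.eq_integral_zero hA hc ht, add_sub_cancel_left]
  have hs : Ioc 0 t ⊆ Ioi 0 := Ioc_subset_Ioi_self
  have := sq_intervalIntegral_le ht.le (memLp_restrict_of_halfLine hA hs)
  rw [sub_zero] at this
  exact this.trans (mul_le_mul_of_nonneg_left (setIntegral_sq_le_halfLine hA hs) ht.le)

end HalfLine

/-- The tail integral `∫_r^∞ u(s)/s ds`. -/
def tail (u : ℝ → ℝ) (r : ℝ) : ℝ := ∫ s in Ioi r, u s / s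

section Tail

variable {a u v : ℝ → ℝ}

lemma tail_congr (huv : u =ᵐ[μ₊] v) {r : ℝ} (hr : 0 < r) : tail u r = tail v r := by
  refine integral_congr_ae ?_
  filter_upwards [ae_restrict_of_ae_restrict_of_subset (Ioi_subset_Ioi hr.le) huv] with s hs
  rw [hs]

lemma tail_add (hu : MemLp u 2 μ₊) (hv : MemLp v 2 μ₊) {r : ℝ} (hr : 0 < r) :
    tail (u + v) r = tail u r + tail v r := by
  unfold tail
  rw [← integral_add (integrableOn_div_Ioi hu hr) (integrableOn_div_Ioi hv hr)]
  simp [add_div]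

lemma tail_smul (c : ℝ) (r : ℝ) : tail (c • u) r = c * tail u r := by
  unfold tail
  rw [← integral_const_mul]
  simp [mul_div_assoc]

/-- Pairs `(u, √2 a T u)` in `L² × L²`, where `T` is the tail integral. -/
def tailGraph (a : ℝ → ℝ) : Submodule ℝ (WithLp 2 (Lp ℝ 2 μ₊ × Lp ℝ 2 μ₊)) where
  carrier := {x | x.snd =ᵐ[μ₊] fun r => √2 * a r * tail x.fst r}
  add_mem' := by
    intro x y hx hy
    simp only [mem_ofPred_eq] at hx hy ⊢
    filter_upwards [hx, hy, Lp.coeFn_add x.snd y.snd, ae_restrict_mem measurableSet_Ioi]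
      with r h1 h2 h3 hr
    rw [WithLp.add_snd, h3, Pi.add_apply, h1, h2, WithLp.add_fst,
      tail_congr (Lp.coeFn_add x.fst y.fst) hr, tail_add (Lp.memLp _) (Lp.memLp _) hr]
    ring
  zero_mem' := by
    simp only [mem_ofPred_eq]
    filter_upwards [Lp.coeFn_zero ℝ 2 μ₊, ae_restrict_mem measurableSet_Ioi] with r h1 hr
    rw [WithLp.zero_snd, h1, WithLp.zero_fst, tail_congr (Lp.coeFn_zero ℝ 2 μ₊) hr]
    simp [tail]
  smul_mem' := by
    intro c x hx
    simp only [mem_ofPred_eq] at hx ⊢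
    filter_upwards [hx, Lp.coeFn_smul c x.snd, ae_restrict_mem measurableSet_Ioi] with r h1 h2 hr
    rw [WithLp.smul_snd, h2, Pi.smul_apply, h1, WithLp.smul_fst,
      tail_congr (Lp.coeFn_smul c x.fst) hr, tail_smul]
    simp only [smul_eq_mul]; ring

lemma mem_tailGraph {x : WithLp 2 (Lp ℝ 2 μ₊ × Lp ℝ 2 μ₊)} :
    x ∈ tailGraph a ↔ x.snd =ᵐ[μ₊] fun r => √2 * a r * tail x.fst r := Iff.rfl

lemma isClosed_tailGraph (a : ℝ → ℝ) :
    IsClosed (tailGraph a : Set (WithLp 2 (Lp ℝ 2 μ₊ × Lp ℝ 2 μ₊))) := by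
  refine IsSeqClosed.isClosed fun x y hx hxy => ?_
  rw [SetLike.mem_coe, mem_tailGraph]
  have hfst : Tendsto (fun n => (x n).fst) atTop (𝓝 y.fst) :=
    (((WithLp.prod_continuous_ofLp 2 _ _).tendsto y).comp hxy).fst_nhds
  have hsnd : Tendsto (fun n => (x n).snd) atTop (𝓝 y.snd) :=
    (((WithLp.prod_continuous_ofLp 2 _ _).tendsto y).comp hxy).snd_nhds
  obtain ⟨φ, hφ, hae⟩ := (tendstoInMeasure_of_tendsto_Lp hsnd).exists_seq_tendsto_ae
  have htail : ∀ r, 0 < r → Tendsto (fun n => tail (x n).fst r) atTop (𝓝 (tail y.fst r)) := by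
    intro r hr
    rw [← tendsto_sub_nhds_zero_iff]
    have hle : ∀ n, ‖tail (x n).fst r - tail y.fst r‖ ≤ √(r⁻¹ * ‖(x n).fst - y.fst‖ ^ 2) := by
      intro n
      refine Real.le_sqrt_of_sq_le ?_
      have e1 : (x n).fst = (x n).fst - y.fst + y.fst := by simp
      have e2 : tail (x n).fst r = tail ((x n).fst - y.fst : Lp ℝ 2 μ₊) r + tail y.fst r := by
        rw [← tail_add (Lp.memLp _) (Lp.memLp _) hr]
        refine tail_congr ?_ hr
        nth_rewrite 1 [e1]
        exact Lp.coeFn_add _ _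
      rw [e2, add_sub_cancel_right, Real.norm_eq_abs, sq_abs]
      have := sq_integral_tail_le (Lp.memLp ((x n).fst - y.fst)) hr
      rwa [← norm_toLp_sq_eq_integral (Lp.memLp ((x n).fst - y.fst)), Lp.toLp_coeFn] at this
    refine squeeze_zero_norm hle ?_
    have := (((hfst.sub_const y.fst).norm.pow 2).const_mul r⁻¹).sqrt
    simpa using this
  filter_upwards [hae, ae_all_iff.2 fun n => mem_tailGraph.1 (hx n),
    ae_restrict_mem measurableSet_Ioi] with r h1 h2 hr
  refine tendsto_nhds_unique h1 ?_
  have h3 := ((htail r hr).comp hφ.tendsto_atTop).const_mul (√2 * a r)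
  exact h3.congr fun n => (h2 (φ n)).symm

/-- Projection theorem for the quadratic form `∫ (u² + 2 a² g²)` with `g = q - ∫_r^∞ u/s ds`. -/
lemma exists_tail_orthogonal (ha : MemLp a 2 μ₊) (q : ℝ) :
    ∃ u : ℝ → ℝ, MemLp u 2 μ₊ ∧ MemLp (fun r => a r * (q - tail u r)) 2 μ₊ ∧
      ∀ v, MemLp v 2 μ₊ → MemLp (fun r => a r * tail v r) 2 μ₊ →
        ∫ r in Ioi (0 : ℝ), (u r * v r - 2 * (a r * (q - tail u r)) * (a r * tail v r)) = 0 := by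
  have : CompleteSpace (tailGraph a) := (isClosed_tailGraph a).completeSpace_coe
  have h0 : MemLp (fun r => √2 * q * a r) 2 μ₊ := ha.const_mul _
  let x0 : WithLp 2 (Lp ℝ 2 μ₊ × Lp ℝ 2 μ₊) := WithLp.toLp 2 (0, h0.toLp _)
  obtain ⟨p, hp, hperp⟩ : ∃ p ∈ tailGraph a, ∀ w ∈ tailGraph a, inner ℝ w (x0 - p) = 0 :=
    ⟨(tailGraph a).starProjection x0, (tailGraph a).starProjection_apply_mem x0,
      (tailGraph a).sub_starProjection_mem_orthogonal x0⟩
  rw [mem_tailGraph] at hp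
  have hs2 : (√2 : ℝ) ≠ 0 := by positivity
  have hs2' : (√2 : ℝ) * √2 = 2 := Real.mul_self_sqrt (by norm_num)
  have hsnd : (x0 - p).snd =ᵐ[μ₊] fun r => √2 * (a r * (q - tail p.fst r)) := by
    filter_upwards [Lp.coeFn_sub (h0.toLp _) p.snd, h0.coeFn_toLp, hp] with r h1 h2 h3
    rw [WithLp.sub_snd, show x0.snd = h0.toLp _ from rfl, h1, Pi.sub_apply, h2, h3]
    ring
  have hfst : (x0 - p).fst =ᵐ[μ₊] fun r => -p.fst r := by
    have : (x0 - p).fst = -p.fst := by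
      rw [WithLp.sub_fst, show x0.fst = 0 from rfl, zero_sub]
    rw [this]
    exact Lp.coeFn_neg _
  have hm : MemLp (fun r => a r * (q - tail p.fst r)) 2 μ₊ := by
    have := ((memLp_congr_ae hsnd).1 (Lp.memLp _)).const_mul (√2)⁻¹
    refine (memLp_congr_ae (Eventually.of_forall fun r => ?_)).1 this
    field_simp
  refine ⟨p.fst, Lp.memLp _, hm, fun v hv hav => ?_⟩
  have hav' : MemLp (fun r => √2 * (a r * tail v r)) 2 μ₊ := hav.const_mul _
  have hw : WithLp.toLp 2 (hv.toLp v, hav'.toLp _) ∈ tailGraph a := by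
    rw [mem_tailGraph]
    filter_upwards [hav'.coeFn_toLp, ae_restrict_mem measurableSet_Ioi] with r h1 hr
    change (hav'.toLp _ : ℝ → ℝ) r = √2 * a r * tail (hv.toLp v) r
    rw [h1, tail_congr hv.coeFn_toLp hr]; ring
  have := hperp _ hw
  rw [WithLp.prod_inner_apply] at this
  simp only [WithLp.ofLp_fst, WithLp.ofLp_snd] at this
  rw [L2.inner_def, L2.inner_def, ← integral_add (L2.integrable_inner _ _)
    (L2.integrable_inner _ _), ← neg_eq_zero, ← integral_neg] at this
  refine Eq.trans (integral_congr_ae ?_) this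
  filter_upwards [hsnd, hfst, hv.coeFn_toLp, hav'.coeFn_toLp] with r h1 h2 h3 h4
  rw [h1, h2]
  simp only [h3, h4, RCLike.inner_apply, conj_trivial]
  linear_combination ((a r * (q - tail p.fst r)) * (a r * tail v r)) * hs2'

end Tail

section Potential

variable {a g : ℝ → ℝ} {q : ℝ}

lemma integral_inv_div_self {c t : ℝ} (hc : 0 < c) (hct : c ≤ t) :
    ∫ r in Ioc c t, r⁻¹ / r = c⁻¹ - t⁻¹ := by
  rw [← intervalIntegral.integral_of_le hct,
    intervalIntegral.integral_eq_sub_of_hasDerivAt (f := fun r => -r⁻¹)]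
  · ring
  · intro r hr
    rw [uIcc_of_le hct] at hr
    have : r ≠ 0 := (hc.trans_le hr.1).ne'
    have h := (hasDerivAt_inv this).neg
    rw [neg_neg, show (r ^ 2)⁻¹ = r⁻¹ / r by field_simp] at h
    exact h
  · refine ContinuousOn.intervalIntegrable fun r hr => ContinuousAt.continuousWithinAt ?_
    rw [uIcc_of_le hct] at hr
    have : r ≠ 0 := (hc.trans_le hr.1).ne'
    exact (continuousAt_inv₀ this).div continuousAt_id this

lemma tail_indicator_inv {s t : ℝ} (hs : 0 < s) (r : ℝ) :
    tail ((Ioc s t).indicator fun r => r⁻¹) r =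
      if max r s ≤ t then (max r s)⁻¹ - t⁻¹ else 0 := by
  have e : (fun x => (Ioc s t).indicator (fun r : ℝ => r⁻¹) x / x)
      = (Ioc s t).indicator fun r => r⁻¹ / r := by
    ext x; by_cases hx : x ∈ Ioc s t <;> simp [hx]
  have e2 : Ioi r ∩ Ioc s t = Ioc (max r s) t := by
    ext x; simp only [mem_inter_iff, mem_Ioi, mem_Ioc, max_lt_iff]; tauto
  rw [tail, e, setIntegral_indicator measurableSet_Ioc, e2]
  split_ifs with h
  · exact integral_inv_div_self (lt_max_of_lt_right hs) h
  · rw [Ioc_eq_empty (by linarith), setIntegral_empty]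

lemma memLp_indicator_inv {s t : ℝ} (hs : 0 < s) :
    MemLp ((Ioc s t).indicator fun r : ℝ => r⁻¹) 2 μ₊ := by
  refine (memLp_indicator_iff_restrict measurableSet_Ioc).2 ?_
  refine (memLp_inv_Ioi hs).mono_measure ?_
  rw [restrict_halfLine (fun r hr => hs.trans hr.1) measurableSet_Ioc]
  exact Measure.restrict_mono_set _ Ioc_subset_Ioi_self

lemma memLp_mul_tail_indicator_inv (ha2 : MemLp a 2 μ₊) {s t : ℝ} (hs : 0 < s) :
    MemLp (fun r => a r * tail ((Ioc s t).indicator fun r => r⁻¹) r) 2 μ₊ := by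
  have hm : Measurable fun r : ℝ => if max r s ≤ t then (max r s)⁻¹ - t⁻¹ else 0 :=
    Measurable.ite (measurableSet_le (by fun_prop) measurable_const) (by fun_prop) measurable_const
  simp only [tail_indicator_inv hs]
  refine (ha2.const_mul s⁻¹).mono (ha2.1.mul hm.aestronglyMeasurable) (ae_of_all _ fun r => ?_)
  rw [norm_mul, norm_mul, mul_comm]
  refine mul_le_mul_of_nonneg_right ?_ (norm_nonneg _)
  have h2 : (0 : ℝ) < s⁻¹ := by positivity
  rw [Real.norm_eq_abs, Real.norm_eq_abs, abs_of_pos h2, abs_le]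
  split_ifs with h
  · have h1 : 0 < max r s := lt_max_of_lt_right hs
    have h3 : t⁻¹ ≤ (max r s)⁻¹ := by gcongr
    have h4 : (max r s)⁻¹ ≤ s⁻¹ := by gcongr; exact le_max_right _ _
    have h5 : 0 < t⁻¹ := by have := h1.trans_le h; positivity
    constructor <;> linarith
  · constructor <;> linarith

/-- The flux `∫₀ʳ 2 a² g`. -/
def flux (a g : ℝ → ℝ) (t : ℝ) : ℝ := ∫ r in (0 : ℝ)..t, 2 * a r ^ 2 * g r

lemma integrable_sq_mul (ha2 : MemLp a 2 μ₊) (hag : MemLp (fun r => a r * g r) 2 μ₊) :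
    IntegrableOn (fun r => 2 * a r ^ 2 * g r) (Ioi 0) := by
  have h : Integrable (fun r => a r * (a r * g r)) μ₊ := ha2.integrable_mul hag
  refine (h.const_mul 2).congr (ae_of_all _ fun r => ?_)
  simp only; ring

lemma intervalIntegrable_sq_mul (ha2 : MemLp a 2 μ₊) (hag : MemLp (fun r => a r * g r) 2 μ₊)
    {s t : ℝ} (hs : 0 ≤ s) (hst : s ≤ t) :
    IntervalIntegrable (fun r => 2 * a r ^ 2 * g r) volume s t :=
  (intervalIntegrable_iff_integrableOn_Ioc_of_le hst).2
    ((integrable_sq_mul ha2 hag).mono_set fun _ hr => hs.trans_lt hr.1)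

lemma hasDerivAt_flux (ha : ContinuousOn a (Ici 0)) (ha2 : MemLp a 2 μ₊)
    (hag : MemLp (fun r => a r * g r) 2 μ₊) (hg : ContinuousOn g (Ioi 0)) {t : ℝ} (ht : 0 < t) :
    HasDerivAt (flux a g) (2 * a t ^ 2 * g t) t := by
  have hc : ContinuousOn (fun r => 2 * a r ^ 2 * g r) (Ioi 0) :=
    (((ha.mono Ioi_subset_Ici_self).pow 2).const_mul 2).mul hg
  refine intervalIntegral.integral_hasDerivAt_right
    (intervalIntegrable_sq_mul ha2 hag le_rfl ht.le) ?_ (hc.continuousAt (Ioi_mem_nhds ht))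
  exact hc.stronglyMeasurableAtFilter isOpen_Ioi _ ht

lemma integral_mul_tail_indicator (ha : ContinuousOn a (Ici 0)) (ha2 : MemLp a 2 μ₊)
    (hag : MemLp (fun r => a r * g r) 2 μ₊) (hg : ContinuousOn g (Ioi 0)) {s t : ℝ} (hs : 0 < s)
    (hst : s ≤ t) :
    ∫ r in Ioi (0 : ℝ), 2 * a r ^ 2 * g r * tail ((Ioc s t).indicator fun r => r⁻¹) r =
      ∫ r in s..t, flux a g r / r ^ 2 := by
  have hc : ContinuousOn (fun r => 2 * a r ^ 2 * g r) (Ioi 0) :=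
    (((ha.mono Ioi_subset_Ici_self).pow 2).const_mul 2).mul hg
  have hsub : uIcc s t ⊆ Ioi 0 := by
    rw [uIcc_of_le hst]; exact fun r hr => hs.trans_le hr.1
  have hpos : ∀ r ∈ uIcc s t, r ≠ 0 := fun r hr => (hsub hr).ne'
  simp only [tail_indicator_inv hs]
  have hfl : ContinuousOn (flux a g) (uIcc s t) := fun r hr =>
    (hasDerivAt_flux ha ha2 hag hg (hsub hr)).continuousAt.continuousWithinAt
  have hinv : ContinuousOn (fun r : ℝ => r⁻¹ - t⁻¹) (uIcc s t) :=
    (continuousOn_inv₀.mono fun r hr => hpos r hr).sub continuousOn_const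
  have hsplit : Ioi (0 : ℝ) = Ioc 0 s ∪ (Ioc s t ∪ Ioi t) := by
    rw [Ioc_union_Ioi_eq_Ioi hst, Ioc_union_Ioi_eq_Ioi hs.le]
  set F : ℝ → ℝ := fun r => 2 * a r ^ 2 * g r * if max r s ≤ t then (max r s)⁻¹ - t⁻¹ else 0
    with hF
  have e1 : EqOn F (fun r => 2 * a r ^ 2 * g r * (s⁻¹ - t⁻¹)) (Ioc 0 s) := fun r hr => by
    simp only [hF, max_eq_right hr.2, hst, if_true]
  have e2 : EqOn F (fun r => (r⁻¹ - t⁻¹) * (2 * a r ^ 2 * g r)) (Ioc s t) := fun r hr => by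
    simp only [hF, max_eq_left hr.1.le, hr.2, if_true]; ring
  have e3 : EqOn F (fun _ => 0) (Ioi t) := fun r hr => by
    have : ¬ max r s ≤ t := by rw [not_le]; exact lt_max_of_lt_left hr
    simp only [hF, this, if_false, mul_zero]
  have i1 : IntegrableOn F (Ioc 0 s) := by
    refine IntegrableOn.congr_fun ?_ e1.symm measurableSet_Ioc
    exact ((integrable_sq_mul ha2 hag).mono_set Ioc_subset_Ioi_self).mul_const _
  have i2 : IntegrableOn F (Ioc s t) := by
    refine IntegrableOn.congr_fun ?_ e2.symm measurableSet_Ioc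
    exact (intervalIntegrable_iff_integrableOn_Ioc_of_le hst).1
      (hinv.mul (hc.mono hsub)).intervalIntegrable
  have i3 : IntegrableOn F (Ioi t) :=
    integrableOn_zero.congr_fun e3.symm measurableSet_Ioi
  change ∫ r in Ioi (0 : ℝ), F r = _
  rw [hsplit, setIntegral_union (by
      rw [Ioc_union_Ioi_eq_Ioi hst, Set.disjoint_left]
      exact fun r h1 h2 => absurd h1.2 (not_le.2 h2)) (measurableSet_Ioc.union measurableSet_Ioi)
      i1 (i2.union i3),
    setIntegral_union (by
      rw [Set.disjoint_left]
      exact fun r h1 h2 => absurd h1.2 (not_le.2 h2)) measurableSet_Ioi i2 i3,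
    setIntegral_congr_fun measurableSet_Ioc e1, setIntegral_congr_fun measurableSet_Ioc e2,
    setIntegral_congr_fun measurableSet_Ioi e3, integral_mul_const,
    ← intervalIntegral.integral_of_le hs.le, ← intervalIntegral.integral_of_le hst,
    intervalIntegral.integral_mul_deriv_eq_deriv_mul (u := fun r => r⁻¹ - t⁻¹) (v := flux a g)
      (u' := fun r => -(r ^ 2)⁻¹)
      (fun r hr => (hasDerivAt_inv (hpos r hr)).sub_const _)
      (fun r hr => hasDerivAt_flux ha ha2 hag hg (hsub hr))
      (ContinuousOn.intervalIntegrable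
        (((continuousOn_pow 2).inv₀ fun r hr => pow_ne_zero 2 (hpos r hr)).neg))
      ((hc.mono hsub).intervalIntegrable)]
  have e4 : ∀ r, -(r ^ 2)⁻¹ * flux a g r = -(flux a g r / r ^ 2) := fun r => by
    rw [div_eq_mul_inv]; ring
  simp only [e4, intervalIntegral.integral_neg, integral_zero]
  change flux a g s * _ + _ = _
  ring

/-- The solution of the constraint equation `(r² g')' = 2 a² g`, `g(∞) = q`, with weak formulation
retained. -/
lemma exists_flux_solution (ha : ContinuousOn a (Ici 0)) (ha2 : MemLp a 2 μ₊) (q : ℝ) :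
    ∃ g : ℝ → ℝ, (∀ r, 0 < r → HasDerivAt g (flux a g r / r ^ 2) r) ∧
      MemLp (fun r => flux a g r / r) 2 μ₊ ∧ MemLp (fun r => a r * g r) 2 μ₊ ∧
      Tendsto g atTop (𝓝 q) ∧
      ∀ v, MemLp v 2 μ₊ → MemLp (fun r => a r * tail v r) 2 μ₊ →
        ∫ r in Ioi (0 : ℝ),
          (flux a g r / r * v r - 2 * (a r * g r) * (a r * tail v r)) = 0 := by
  obtain ⟨u, hu, hag, horth⟩ := exists_tail_orthogonal ha2 q
  set g : ℝ → ℝ := fun r => q - tail u r with hgdef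
  have hP : IsPrimitive g (fun r => u r / r) := isPrimitive_tail hu q
  have hg : ContinuousOn g (Ioi 0) := hP.continuousOn
  have hfl : ContinuousOn (fun r => flux a g r / r ^ 2) (Ioi 0) := fun r hr =>
    ((hasDerivAt_flux ha ha2 hag hg hr).continuousAt.div (continuousAt_id.pow 2)
      (pow_ne_zero 2 (ne_of_gt hr))).continuousWithinAt
  have hkey : ∀ s t, 0 < s → s ≤ t → g t - g s = ∫ r in s..t, flux a g r / r ^ 2 := by
    intro s t hs hst
    have h1 := horth _ (memLp_indicator_inv (t := t) hs) (memLp_mul_tail_indicator_inv ha2 hs)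
    have i1 : Integrable (fun r => u r * (Ioc s t).indicator (fun r => r⁻¹) r) μ₊ :=
      hu.integrable_mul (memLp_indicator_inv hs)
    have i2 : Integrable (fun r => (a r * g r) *
        (a r * tail ((Ioc s t).indicator fun r => r⁻¹) r)) μ₊ :=
      hag.integrable_mul (memLp_mul_tail_indicator_inv ha2 hs)
    have i3 : Integrable (fun r => 2 * (a r * g r) *
        (a r * tail ((Ioc s t).indicator fun r => r⁻¹) r)) μ₊ := by
      refine (i2.const_mul 2).congr (ae_of_all _ fun r => ?_)
      simp only; ring
    rw [integral_sub i1 i3, sub_eq_zero] at h1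
    rw [(hP s t hs hst).2, ← integral_mul_tail_indicator ha ha2 hag hg hs hst,
      intervalIntegral.integral_of_le hst]
    have e1 : (fun r => u r * (Ioc s t).indicator (fun r => r⁻¹) r)
        = (Ioc s t).indicator fun r => u r / r := by
      ext r; by_cases hr : r ∈ Ioc s t <;> simp [hr, div_eq_mul_inv]
    rw [e1, setIntegral_indicator measurableSet_Ioc,
      show Ioi 0 ∩ Ioc s t = Ioc s t from inter_eq_right.2 fun r hr => hs.trans hr.1] at h1
    rw [h1]
    refine integral_congr_ae (ae_of_all _ fun r => ?_)
    simp only; ring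
  have hd : ∀ r, 0 < r → HasDerivAt g (flux a g r / r ^ 2) r := by
    intro r hr
    have hr2 : 0 < r / 2 := by positivity
    have h1 : HasDerivAt (fun t => g (r / 2) + ∫ x in (r / 2)..t, flux a g x / x ^ 2)
        (flux a g r / r ^ 2) r := by
      refine (intervalIntegral.integral_hasDerivAt_right ?_
        (hfl.stronglyMeasurableAtFilter isOpen_Ioi _ hr)
        (hfl.continuousAt (Ioi_mem_nhds hr))).const_add _
      refine (hfl.mono ?_).intervalIntegrable
      rw [uIcc_of_le (by linarith)]; exact fun x hx => hr2.trans_le hx.1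
    refine h1.congr_of_eventuallyEq ?_
    filter_upwards [Ioi_mem_nhds (show r / 2 < r by linarith)] with t ht
    rw [← hkey (r / 2) t hr2 (le_of_lt ht)]; ring
  have hae : u =ᵐ[μ₊] fun r => flux a g r / r := by
    filter_upwards [hP.ae_hasDerivAt, ae_restrict_mem measurableSet_Ioi] with r h1 hr
    have hr : 0 < r := hr
    have := h1.unique (hd r hr)
    field_simp at this ⊢
    linarith
  refine ⟨g, hd, (memLp_congr_ae hae).1 hu, hag, tendsto_tail hu q, fun v hv hav => ?_⟩
  refine Eq.trans (integral_congr_ae ?_) (horth v hv hav)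
  filter_upwards [hae] with r hr
  rw [hr]

end Potential

lemma memLp_two_of_sq_le {α : Type*} {m : MeasurableSpace α} {μ : Measure α} {x B : α → ℝ}
    (hx : AEStronglyMeasurable x μ) (hB : Integrable B μ) (hle : ∀ᵐ r ∂μ, x r ^ 2 ≤ B r) :
    MemLp x 2 μ := by
  refine (memLp_two_iff_integrable_sq hx).2 (hB.mono' (hx.pow 2) ?_)
  filter_upwards [hle] with r hr
  rwa [Real.norm_eq_abs, abs_of_nonneg (sq_nonneg _)]

lemma continuousOn_Ici_of_tendsto {h : ℝ → ℝ} (hc : ContinuousOn h (Ioi 0))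
    (h0 : Tendsto h (𝓝[>] 0) (𝓝 (h 0))) : ContinuousOn h (Ici 0) := by
  intro x hx
  rcases eq_or_lt_of_le (show (0 : ℝ) ≤ x from hx) with rfl | hx
  · exact continuousWithinAt_Ioi_iff_Ici.1 h0
  · exact (hc.continuousAt (Ioi_mem_nhds hx)).continuousWithinAt

section CalE2

variable {a h : ℝ → ℝ}

lemma memLp_mul_deriv_of_calE2 (hE : IntegrableOn (calE2 a h) (Ioi 0)) :
    MemLp (fun r => r * deriv h r) 2 μ₊ := by
  refine memLp_two_of_sq_le
    (measurable_id.mul (measurable_deriv h)).aestronglyMeasurable hE (ae_of_all _ fun r => ?_)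
  unfold calE2
  nlinarith [sq_nonneg (a r * h r)]

lemma memLp_mul_of_calE2 (ha : ContinuousOn a (Ioi 0)) (hh : ContinuousOn h (Ioi 0))
    (hE : IntegrableOn (calE2 a h) (Ioi 0)) : MemLp (fun r => a r * h r) 2 μ₊ := by
  refine memLp_two_of_sq_le ((ha.mul hh).aestronglyMeasurable measurableSet_Ioi) hE
    (ae_of_all _ fun r => ?_)
  unfold calE2
  nlinarith [sq_nonneg (a r * h r), sq_nonneg (r * deriv h r)]

lemma integrableOn_calE2 (h1 : MemLp (fun r => r * deriv h r) 2 μ₊)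
    (h2 : MemLp (fun r => a r * h r) 2 μ₊) : IntegrableOn (calE2 a h) (Ioi 0) := by
  refine (h1.integrable_sq.add (h2.integrable_sq.const_mul 2)).congr (ae_of_all _ fun r => ?_)
  simp only [calE2, Pi.add_apply]; ring

end CalE2

section Potential

variable {a g : ℝ → ℝ} {q : ℝ}

lemma sq_flux_le (ha2 : MemLp a 2 μ₊) (hag : MemLp (fun r => a r * g r) 2 μ₊) {t : ℝ} (ht : 0 < t) :
    flux a g t ^ 2 ≤ 4 * ((∫ r in Ioc 0 t, a r ^ 2) * ∫ r in Ioc 0 t, (a r * g r) ^ 2) := by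
  have h := sq_integral_mul_le (memLp_restrict_of_halfLine ha2 (s := Ioc 0 t) Ioc_subset_Ioi_self)
    (memLp_restrict_of_halfLine hag (s := Ioc 0 t) Ioc_subset_Ioi_self)
  have e : flux a g t = 2 * ∫ r in Ioc 0 t, a r * (a r * g r) := by
    rw [flux, intervalIntegral.integral_of_le ht.le, ← integral_const_mul]
    refine integral_congr_ae (ae_of_all _ fun r => ?_)
    simp only; ring
  rw [e, mul_pow]
  linarith

lemma tendsto_flux_mul (ha : ContinuousOn a (Ici 0)) (ha2 : MemLp a 2 μ₊)
    (hag : MemLp (fun r => a r * g r) 2 μ₊)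
    (hd : ∀ r, 0 < r → HasDerivAt g (flux a g r / r ^ 2) r)
    (hfl : MemLp (fun r => flux a g r / r) 2 μ₊) (hlim : Tendsto g atTop (𝓝 q)) :
    Tendsto (fun r => flux a g r * g r) (𝓝[>] 0) (𝓝 0) := by
  have hg : ContinuousOn g (Ioi 0) := fun r hr => (hd r hr).continuousAt.continuousWithinAt
  have hP : IsPrimitive g (fun r => flux a g r / r ^ 2) :=
    IsPrimitive.of_hasDerivAt hd fun r hr =>
      ((hasDerivAt_flux ha ha2 hag hg hr).continuousAt.div (continuousAt_id.pow 2)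
        (pow_ne_zero 2 (ne_of_gt hr))).continuousWithinAt
  have e : (fun r => r * (flux a g r / r ^ 2)) = fun r => flux a g r / r := by
    funext r
    rcases eq_or_ne r 0 with rfl | hr
    · simp
    · field_simp
  obtain ⟨B, hB⟩ := isCompact_Icc.exists_bound_of_continuousOn
    (ha.mono (show Icc 0 1 ⊆ Ici (0 : ℝ) from Icc_subset_Ici_self))
  set N := ∫ r in Ioi (0 : ℝ), (flux a g r / r) ^ 2
  have hN : 0 ≤ N := integral_nonneg fun _ => sq_nonneg _
  set J : ℝ → ℝ := fun t => ∫ r in (0 : ℝ)..t, (a r * g r) ^ 2 with hJ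
  have hJlim : Tendsto J (𝓝[>] 0) (𝓝 0) := by
    have hi : IntegrableOn (fun r => (a r * g r) ^ 2) (uIcc 0 1) := by
      rw [uIcc_of_le zero_le_one, integrableOn_Icc_iff_integrableOn_Ioc]
      exact integrableOn_sq_of_halfLine hag Ioc_subset_Ioi_self
    have h1 := intervalIntegral.continuousOn_primitive_interval hi 0 left_mem_uIcc
    have h2 : Tendsto J (𝓝[uIcc 0 1] 0) (𝓝 0) := by
      have := h1.tendsto
      simpa [hJ] using this
    refine h2.mono_left ?_
    rw [uIcc_of_le zero_le_one, ← nhdsWithin_Ioo_eq_nhdsGT (zero_lt_one (α := ℝ))]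
    exact nhdsWithin_mono _ Ioo_subset_Icc_self
  have hbound : ∀ᶠ r in 𝓝[>] (0 : ℝ),
      ‖flux a g r * g r‖ ≤ √(8 * B ^ 2 * (q ^ 2 + N) * J r) := by
    filter_upwards [Ioo_mem_nhdsGT (zero_lt_one (α := ℝ))] with r hr
    have hr0 := hr.1
    refine Real.le_sqrt_of_sq_le ?_
    rw [Real.norm_eq_abs, sq_abs, mul_pow]
    have h1 : flux a g r ^ 2 ≤ 4 * (B ^ 2 * r * J r) := by
      refine (sq_flux_le ha2 hag hr0).trans ?_
      rw [hJ]
      simp only [intervalIntegral.integral_of_le hr0.le]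
      have h3 : ∫ x in Ioc 0 r, a x ^ 2 ≤ B ^ 2 * r := by
        have := setIntegral_mono_on (integrableOn_sq_of_halfLine ha2 Ioc_subset_Ioi_self)
          (integrableOn_const (C := B ^ 2) (measure_Ioc_lt_top (a := (0 : ℝ)) (b := r)).ne)
          measurableSet_Ioc (fun x hx => by
            have := hB x ⟨hx.1.le, hx.2.trans hr.2.le⟩
            rw [Real.norm_eq_abs] at this
            exact sq_le_sq' (abs_le.1 this).1 (abs_le.1 this).2)
        simpa [hr0.le, mul_comm] using this
      have h4 : 0 ≤ ∫ x in Ioc 0 r, (a x * g x) ^ 2 := integral_nonneg fun _ => sq_nonneg _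
      gcongr
    have h2 : r * g r ^ 2 ≤ 2 * (q ^ 2 + N) := by
      have h3 := hP.sq_sub_limit_le (by rwa [e]) hlim hr0
      have h3' : (g r - q) ^ 2 ≤ r⁻¹ * N := by
        refine h3.trans (le_of_eq ?_)
        congr 1
        refine integral_congr_ae (ae_of_all _ fun x => ?_)
        exact congrArg (· ^ 2) (congrFun e x)
      have h4 : r * (g r - q) ^ 2 ≤ N := by
        calc _ ≤ r * (r⁻¹ * N) := by gcongr
          _ = N := by field_simp
      nlinarith [sq_nonneg (g r - 2 * q), hr.2, sq_nonneg q]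
    have hJ0 : 0 ≤ J r := by
      rw [hJ]
      simp only [intervalIntegral.integral_of_le hr0.le]
      exact integral_nonneg fun _ => sq_nonneg _
    calc flux a g r ^ 2 * g r ^ 2 ≤ 4 * (B ^ 2 * r * J r) * g r ^ 2 := by gcongr
      _ = 4 * B ^ 2 * J r * (r * g r ^ 2) := by ring
      _ ≤ 4 * B ^ 2 * J r * (2 * (q ^ 2 + N)) := by gcongr
      _ = _ := by ring
  refine squeeze_zero_norm' hbound ?_
  have := (hJlim.const_mul (8 * B ^ 2 * (q ^ 2 + N))).sqrt
  simpa using this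

lemma flux_mul_nonneg (ha : ContinuousOn a (Ici 0)) (ha2 : MemLp a 2 μ₊)
    (hag : MemLp (fun r => a r * g r) 2 μ₊)
    (hd : ∀ r, 0 < r → HasDerivAt g (flux a g r / r ^ 2) r)
    (hfl : MemLp (fun r => flux a g r / r) 2 μ₊) (hlim : Tendsto g atTop (𝓝 q)) {r : ℝ}
    (hr : 0 < r) : 0 ≤ flux a g r * g r := by
  have hg : ContinuousOn g (Ioi 0) := fun r hr => (hd r hr).continuousAt.continuousWithinAt
  have hd' : ∀ t, 0 < t → HasDerivAt (fun t => flux a g t * g t)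
      (2 * a t ^ 2 * g t * g t + flux a g t * (flux a g t / t ^ 2)) t := fun t ht =>
    (hasDerivAt_flux ha ha2 hag hg ht).mul (hd t ht)
  have hmono : MonotoneOn (fun t => flux a g t * g t) (Ioi 0) := by
    refine monotoneOn_of_deriv_nonneg (convex_Ioi 0)
      (fun t ht => (hd' t ht).continuousAt.continuousWithinAt) ?_ ?_
    · rw [interior_Ioi]
      exact fun t ht => (hd' t ht).differentiableAt.differentiableWithinAt
    · rw [interior_Ioi]
      intro t ht
      rw [(hd' t ht).deriv,
        show 2 * a t ^ 2 * g t * g t + flux a g t * (flux a g t / t ^ 2)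
          = 2 * (a t * g t) ^ 2 + (flux a g t / t) ^ 2 by rw [div_pow]; ring]
      positivity
  refine le_of_tendsto (tendsto_flux_mul ha ha2 hag hd hfl hlim) ?_
  filter_upwards [Ioo_mem_nhdsGT hr] with t ht
  exact hmono ht.1 hr ht.2.le

lemma monotoneOn_sq_of_flux (ha : ContinuousOn a (Ici 0)) (ha2 : MemLp a 2 μ₊)
    (hag : MemLp (fun r => a r * g r) 2 μ₊)
    (hd : ∀ r, 0 < r → HasDerivAt g (flux a g r / r ^ 2) r)
    (hfl : MemLp (fun r => flux a g r / r) 2 μ₊) (hlim : Tendsto g atTop (𝓝 q)) :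
    MonotoneOn (fun r => g r ^ 2) (Ioi 0) := by
  have hd' : ∀ t, 0 < t → HasDerivAt (fun t => g t ^ 2) (2 * (flux a g t * g t / t ^ 2)) t :=
    fun t ht => by
      have := (hd t ht).pow 2
      refine this.congr_deriv ?_
      simp; ring
  refine monotoneOn_of_deriv_nonneg (convex_Ioi 0)
    (fun t ht => (hd' t ht).continuousAt.continuousWithinAt) ?_ ?_
  · rw [interior_Ioi]
    exact fun t ht => (hd' t ht).differentiableAt.differentiableWithinAt
  · rw [interior_Ioi]
    intro t ht
    rw [(hd' t ht).deriv]
    have := flux_mul_nonneg ha ha2 hag hd hfl hlim ht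
    positivity

lemma nonneg_of_monotoneOn_sq (hg : ContinuousOn g (Ioi 0))
    (hmono : MonotoneOn (fun r => g r ^ 2) (Ioi 0)) (hlim : Tendsto g atTop (𝓝 q)) (hq : 0 < q)
    {r : ℝ} (hr : 0 < r) : 0 ≤ g r := by
  by_contra! hneg
  obtain ⟨z, hz, hrz⟩ := ((hlim.eventually (lt_mem_nhds hq)).and (eventually_gt_atTop r)).exists
  have hsub : Icc r z ⊆ Ioi 0 := fun x hx => hr.trans_le hx.1
  obtain ⟨y, hy, hy0⟩ := intermediate_value_Icc hrz.le (hg.mono hsub) ⟨hneg.le, hz.le⟩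
  have := hmono hr (hsub hy) hy.1
  simp only [hy0] at this
  nlinarith

/-- `g` solves the constraint equation determined by `a`, with `g(∞) = q`. -/
structure IsPotential (a : ℝ → ℝ) (q : ℝ) (g : ℝ → ℝ) : Prop where
  locAC : LocAC g
  mem_Icc : ∀ r, 0 < r → 0 ≤ g r ∧ g r ≤ q
  tendsto : Tendsto g atTop (𝓝 q)
  integrableOn : IntegrableOn (calE2 a g) (Ioi 0)
  orthogonal : ∀ G : ℝ → ℝ, LocACIoi G → Tendsto G atTop (𝓝 0) →
    IntegrableOn (fun r => r ^ 2 * (deriv G r) ^ 2 + 2 * (a r) ^ 2 * (G r) ^ 2) (Ioi 0) →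
    IntegrableOn (fun r => r ^ 2 * deriv g r * deriv G r + 2 * (a r) ^ 2 * g r * G r) (Ioi 0) ∧
    ∫ r in Ioi (0 : ℝ), (r ^ 2 * deriv g r * deriv G r + 2 * (a r) ^ 2 * g r * G r) = 0

lemma exists_isPotential (ha : ContinuousOn a (Ici 0)) (ha2 : MemLp a 2 μ₊) (hq : 0 < q) :
    ∃ g : ℝ → ℝ, IsPotential a q g := by
  obtain ⟨g, hd, hfl, hag, hlim, horth⟩ := exists_flux_solution ha ha2 q
  have hg : ContinuousOn g (Ioi 0) := fun r hr => (hd r hr).continuousAt.continuousWithinAt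
  have hsq := monotoneOn_sq_of_flux ha ha2 hag hd hfl hlim
  have hnn : ∀ r, 0 < r → 0 ≤ g r := fun r hr => nonneg_of_monotoneOn_sq hg hsq hlim hq hr
  have hmono : MonotoneOn g (Ioi 0) := fun x hx y hy hxy =>
    (pow_le_pow_iff_left₀ (hnn x hx) (hnn y hy) two_ne_zero).1 (hsq hx hy hxy)
  have hle : ∀ r, 0 < r → g r ≤ q := fun r hr => ge_of_tendsto hlim <| by
    filter_upwards [eventually_ge_atTop r] with t ht using hmono hr (hr.trans_le ht) ht
  have h0 := hmono.tendsto_nhdsGT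
    ⟨0, by rintro _ ⟨r, hr, rfl⟩; exact hnn r hr⟩
  set g₁ : ℝ → ℝ := fun r => if 0 < r then g r else sInf (g '' Ioi 0) with hg₁
  have heq : ∀ r, 0 < r → g₁ r = g r := fun r hr => by simp [hg₁, hr]
  have hev : ∀ r, 0 < r → g₁ =ᶠ[𝓝 r] g := fun r hr => by
    filter_upwards [Ioi_mem_nhds hr] with t ht using heq t ht
  have hd₁ : ∀ r, 0 < r → HasDerivAt g₁ (flux a g r / r ^ 2) r := fun r hr =>
    (hd r hr).congr_of_eventuallyEq (hev r hr)
  have hP : IsPrimitive g₁ (fun r => flux a g r / r ^ 2) :=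
    IsPrimitive.of_hasDerivAt hd₁ fun r hr =>
      ((hasDerivAt_flux ha ha2 hag hg hr).continuousAt.div (continuousAt_id.pow 2)
        (pow_ne_zero 2 (ne_of_gt hr))).continuousWithinAt
  have hmd : MemLp (fun r => r * deriv g₁ r) 2 μ₊ := by
    refine (memLp_congr_ae ?_).1 hfl
    filter_upwards [ae_restrict_mem measurableSet_Ioi] with r hr
    have hr : 0 < r := hr
    rw [(hd₁ r hr).deriv]; field_simp
  have hag₁ : MemLp (fun r => a r * g₁ r) 2 μ₊ := by
    refine (memLp_congr_ae ?_).1 hag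
    filter_upwards [ae_restrict_mem measurableSet_Ioi] with r hr
    rw [heq r hr]
  refine ⟨g₁, ⟨continuousOn_Ici_of_tendsto hP.continuousOn ?_, hP.locACIoi⟩,
    fun r hr => by rw [heq r hr]; exact ⟨hnn r hr, hle r hr⟩,
    hlim.congr' ?_, integrableOn_calE2 hmd hag₁, fun G hG hG0 hGE => ?_⟩
  · rw [show g₁ 0 = sInf (g '' Ioi 0) by simp [hg₁]]
    refine h0.congr' ?_
    filter_upwards [self_mem_nhdsWithin] with r hr using (heq r hr).symm
  · filter_upwards [eventually_gt_atTop 0] with r hr using (heq r hr).symm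
  · have hGc := hG.isPrimitive.continuousOn
    have hv := memLp_mul_deriv_of_calE2 (a := a) (h := G) hGE
    have haG := memLp_mul_of_calE2 (ha.mono Ioi_subset_Ici_self) hGc hGE
    have htail : ∀ r, 0 < r → tail (fun r => r * deriv G r) r = -G r := fun r hr => by
      rw [hG.isPrimitive.eq_sub_tail hv hG0 hr, tail]; ring
    have hat : MemLp (fun r => a r * tail (fun r => r * deriv G r) r) 2 μ₊ := by
      refine (memLp_congr_ae ?_).1 haG.neg
      filter_upwards [ae_restrict_mem measurableSet_Ioi] with r hr
      rw [htail r hr]; simp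
    have hae : (fun r => flux a g r / r * (r * deriv G r)
        - 2 * (a r * g r) * (a r * tail (fun r => r * deriv G r) r)) =ᵐ[μ₊]
        fun r => r ^ 2 * deriv g₁ r * deriv G r + 2 * (a r) ^ 2 * g₁ r * G r := by
      filter_upwards [ae_restrict_mem measurableSet_Ioi] with r hr
      have hr' : 0 < r := hr
      rw [htail r hr, heq r hr, (hd₁ r hr).deriv]
      field_simp; ring
    have i1 : Integrable (fun r => flux a g r / r * (r * deriv G r)) μ₊ := hfl.integrable_mul hv
    have i2 : Integrable (fun r => a r * g r * (a r * tail (fun r => r * deriv G r) r)) μ₊ :=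
      hag.integrable_mul hat
    refine ⟨?_, ?_⟩
    · refine Integrable.congr (i1.sub (i2.const_mul 2)) (EventuallyEq.trans ?_ hae)
      refine ae_of_all _ fun r => ?_
      simp only [Pi.sub_apply]; ring
    · rw [← integral_congr_ae hae]
      exact horth _ hv hat

end Potential

section Energy

variable {κ ω q : ℝ} {a f g h : ℝ → ℝ}

lemma calE2_nonneg (a g : ℝ → ℝ) (r : ℝ) : 0 ≤ calE2 a g r := by unfold calE2; positivity

lemma calE1_nonneg (hκ : 0 < κ) (a f : ℝ → ℝ) (r : ℝ) : 0 ≤ calE1 κ a f r := by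
  unfold calE1; positivity

lemma sq_deriv_le_calE1 (hκ : 0 < κ) (a f : ℝ → ℝ) (r : ℝ) : deriv a r ^ 2 ≤ calE1 κ a f r := by
  have : 0 ≤ 3 * deriv a r ^ 2 + 2 * (((a r) ^ 2 - 1) ^ 2 / r ^ 2)
    + (1 / 2) * (r ^ 2 * (deriv f r) ^ 2 + 2 * (a r) ^ 2 * Real.sin (f r) ^ 2)
    + 2 * κ * (a r) ^ 2 * Real.sin (f r) ^ 2
        * (2 * (deriv f r) ^ 2 + (a r) ^ 2 * Real.sin (f r) ^ 2 / r ^ 2) := by positivity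
  unfold calE1; linarith

lemma sq_mul_deriv_le_calE1 (hκ : 0 < κ) (a f : ℝ → ℝ) (r : ℝ) :
    (r * deriv f r) ^ 2 + 2 * (a r * sin (f r)) ^ 2 ≤ 2 * calE1 κ a f r := by
  have : 0 ≤ 2 * (2 * (deriv a r) ^ 2 + ((a r) ^ 2 - 1) ^ 2 / r ^ 2)
      + 2 * κ * (a r) ^ 2 * Real.sin (f r) ^ 2
        * (2 * (deriv f r) ^ 2 + (a r) ^ 2 * Real.sin (f r) ^ 2 / r ^ 2) := by positivity
  unfold calE1; linarith

lemma sq_cross_le_calE1 (hκ : 0 < κ) (a f : ℝ → ℝ) (r : ℝ) :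
    4 * κ * (a r * sin (f r) * deriv f r) ^ 2 ≤ calE1 κ a f r := by
  have : 0 ≤ 2 * (2 * (deriv a r) ^ 2 + ((a r) ^ 2 - 1) ^ 2 / r ^ 2)
    + (1 / 2) * (r ^ 2 * (deriv f r) ^ 2 + 2 * (a r) ^ 2 * Real.sin (f r) ^ 2)
    + 2 * κ * (a r) ^ 2 * Real.sin (f r) ^ 2
        * ((a r) ^ 2 * Real.sin (f r) ^ 2 / r ^ 2) := by positivity
  unfold calE1; linarith

lemma aestronglyMeasurable_comp_sin (hf : ContinuousOn f (Ioi 0)) :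
    AEStronglyMeasurable (fun r => Real.sin (f r)) μ₊ :=
  (Real.continuous_sin.comp_continuousOn hf).aestronglyMeasurable measurableSet_Ioi

lemma aestronglyMeasurable_calE1 (ha : ContinuousOn a (Ioi 0)) (hf : ContinuousOn f (Ioi 0)) :
    AEStronglyMeasurable (calE1 κ a f) μ₊ := by
  have m1 := (ha.aestronglyMeasurable (μ := volume) measurableSet_Ioi).aemeasurable
  have m2 := (aestronglyMeasurable_comp_sin hf).aemeasurable
  have m3 := (measurable_deriv a).aemeasurable (μ := μ₊)
  have m4 := (measurable_deriv f).aemeasurable (μ := μ₊)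
  have m5 : AEMeasurable (fun r : ℝ => r) μ₊ := aemeasurable_id
  refine AEMeasurable.aestronglyMeasurable ?_
  unfold calE1
  fun_prop

lemma aestronglyMeasurable_calE2 (ha : ContinuousOn a (Ioi 0)) (hg : ContinuousOn g (Ioi 0)) :
    AEStronglyMeasurable (calE2 a g) μ₊ := by
  have m1 := (ha.aestronglyMeasurable (μ := volume) measurableSet_Ioi).aemeasurable
  have m2 := (hg.aestronglyMeasurable (μ := volume) measurableSet_Ioi).aemeasurable
  have m3 := (measurable_deriv g).aemeasurable (μ := μ₊)
  refine AEMeasurable.aestronglyMeasurable ?_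
  unfold calE2
  fun_prop

lemma LocAC.continuousOn_Ioi (hh : LocAC h) : ContinuousOn h (Ioi 0) :=
  hh.1.mono Ioi_subset_Ici_self

lemma Admissible.integrableOn_calE1 (hκ : 0 < κ) (hA : Admissible κ ω q a f g) :
    IntegrableOn (calE1 κ a f) (Ioi 0) := by
  refine hA.finite_energy.mono' (aestronglyMeasurable_calE1 hA.locAC_a.continuousOn_Ioi
    hA.locAC_f.continuousOn_Ioi) (ae_of_all _ fun r => ?_)
  rw [Real.norm_eq_abs, abs_of_nonneg (calE1_nonneg hκ a f r)]
  linarith [calE2_nonneg a g r]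

lemma Admissible.integrableOn_calE2 (hκ : 0 < κ) (hA : Admissible κ ω q a f g) :
    IntegrableOn (calE2 a g) (Ioi 0) := by
  refine hA.finite_energy.mono' (aestronglyMeasurable_calE2 hA.locAC_a.continuousOn_Ioi
    hA.locAC_g.continuousOn_Ioi) (ae_of_all _ fun r => ?_)
  rw [Real.norm_eq_abs, abs_of_nonneg (calE2_nonneg a g r)]
  linarith [calE1_nonneg hκ a f r]

lemma Constrained.integral_calE2_le (hκ : 0 < κ) (hC : Constrained κ ω q a f g)
    (hh : LocACIoi h) (hlim : Tendsto h atTop (𝓝 q)) (hE : IntegrableOn (calE2 a h) (Ioi 0)) :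
    ∫ r in Ioi (0 : ℝ), calE2 a g r ≤ ∫ r in Ioi (0 : ℝ), calE2 a h r := by
  obtain ⟨hA, hC⟩ := hC
  have hEg := hA.integrableOn_calE2 hκ
  have hac := hA.locAC_a.continuousOn_Ioi
  have hP := hh.isPrimitive.sub hA.locAC_g.isPrimitive
  have hder := hP.deriv_ae_eq
  have m1 : MemLp (fun r => r * deriv (fun r => h r - g r) r) 2 μ₊ := by
    refine (memLp_congr_ae ?_).1
      ((memLp_mul_deriv_of_calE2 hE).sub (memLp_mul_deriv_of_calE2 hEg))
    filter_upwards [hder] with r hr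
    rw [hr, Pi.sub_apply]; ring
  have m2 : MemLp (fun r => a r * (h r - g r)) 2 μ₊ := by
    refine (memLp_congr_ae (ae_of_all _ fun r => ?_)).1
      ((memLp_mul_of_calE2 hac hh.isPrimitive.continuousOn hE).sub
        (memLp_mul_of_calE2 hac hA.locAC_g.continuousOn_Ioi hEg))
    rw [Pi.sub_apply]; ring
  have hEG := _root_.integrableOn_calE2 m1 m2
  obtain ⟨hi, h0⟩ := hC _ hP.locACIoi (by simpa using hlim.sub hA.g_infty) hEG
  have hsum : ∫ r in Ioi (0 : ℝ), calE2 a h r = ∫ r in Ioi (0 : ℝ), (calE2 a g r + 2 *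
      (r ^ 2 * deriv g r * deriv (fun r => h r - g r) r + 2 * (a r) ^ 2 * g r * (h r - g r))
      + calE2 a (fun r => h r - g r) r) := by
    refine integral_congr_ae ?_
    filter_upwards [hder] with r hr
    simp only [calE2, hr]; ring
  have i1 : Integrable (fun r => calE2 a g r + 2 *
      (r ^ 2 * deriv g r * deriv (fun r => h r - g r) r + 2 * (a r) ^ 2 * g r * (h r - g r))) μ₊ :=
    hEg.add (hi.const_mul 2)
  rw [hsum, integral_add i1 hEG, integral_add hEg (hi.const_mul 2), integral_const_mul, h0]
  have := setIntegral_nonneg (μ := volume) (measurableSet_Ioi (a := (0 : ℝ)))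
    fun r _ => calE2_nonneg a (fun r => h r - g r) r
  simp only [mul_zero, add_zero]
  linarith

lemma Constrained.of_isPotential (ha : LocAC a) (hf : LocAC f) (ha0 : a 0 = 1) (hf0 : f 0 = 0)
    (haI : Tendsto a atTop (𝓝 0)) (hfI : Tendsto f atTop (𝓝 (π - ω)))
    (hE : IntegrableOn (calE1 κ a f) (Ioi 0)) (hg : IsPotential a q g) :
    Constrained κ ω q a f g :=
  ⟨⟨ha, hf, hg.locAC, ha0, hf0, haI, hfI, hg.tendsto, hE.add hg.integrableOn⟩, hg.orthogonal⟩

lemma two_mul_sq_lt_sq_sin (hq0 : 0 < q)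
    (hq2 : q < (1 / √2) * Real.sin ω) : 2 * q ^ 2 < Real.sin ω ^ 2 := by
  have h2 : (√2) ^ 2 = 2 := Real.sq_sqrt (by norm_num)
  have h3 : √2 * q < Real.sin ω := by
    have : (0 : ℝ) < √2 := by positivity
    calc √2 * q < √2 * ((1 / √2) * Real.sin ω) := by gcongr
      _ = Real.sin ω := by field_simp
  calc 2 * q ^ 2 = (√2 * q) ^ 2 := by rw [mul_pow, h2]
    _ < _ := by gcongr

lemma sin_pos_of_mem (hω : ω ∈ Ioo (π / 2) π) : 0 < Real.sin ω :=
  Real.sin_pos_of_pos_of_lt_pi (by linarith [hω.1, Real.pi_pos]) hω.2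

lemma Constrained.integral_calE2_le_mul (hκ : 0 < κ) (hω : ω ∈ Ioo (π / 2) π)
    (hC : Constrained κ ω q a f g) :
    ∫ r in Ioi (0 : ℝ), calE2 a g r ≤
      2 * (q / Real.sin ω) ^ 2 * ∫ r in Ioi (0 : ℝ), calE1 κ a f r := by
  have hA := hC.1
  have hE1 := hA.integrableOn_calE1 hκ
  set c := q / Real.sin ω with hc
  have hP := hA.locAC_f.isPrimitive.sin.const_mul c
  have hlim : Tendsto (fun r => c * Real.sin (f r)) atTop (𝓝 q) := by
    have := ((Real.continuous_sin.tendsto _).comp hA.f_infty).const_mul c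
    rwa [Real.sin_pi_sub, hc, div_mul_cancel₀ _ (sin_pos_of_mem hω).ne'] at this
  have hle : ∀ᵐ r ∂μ₊, calE2 a (fun r => c * Real.sin (f r)) r ≤ 2 * c ^ 2 * calE1 κ a f r := by
    filter_upwards [hP.deriv_ae_eq] with r hr
    rw [calE2, hr]
    have h1 := sq_mul_deriv_le_calE1 hκ a f r
    calc _ = c ^ 2 * (Real.cos (f r) ^ 2 * (r * deriv f r) ^ 2 + 2 * (a r * Real.sin (f r)) ^ 2) := by
          ring
      _ ≤ c ^ 2 * (1 * (r * deriv f r) ^ 2 + 2 * (a r * Real.sin (f r)) ^ 2) := by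
          gcongr; exact Real.cos_sq_le_one _
      _ ≤ c ^ 2 * (2 * calE1 κ a f r) := by rw [one_mul]; gcongr
      _ = _ := by ring
  have hE2 : IntegrableOn (calE2 a fun r => c * Real.sin (f r)) (Ioi 0) := by
    refine (hE1.const_mul (2 * c ^ 2)).mono'
      (aestronglyMeasurable_calE2 hA.locAC_a.continuousOn_Ioi hP.continuousOn) ?_
    filter_upwards [hle] with r hr
    rwa [Real.norm_eq_abs, abs_of_nonneg (calE2_nonneg _ _ r)]
  refine (hC.integral_calE2_le hκ hP.locACIoi hlim hE2).trans ?_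
  rw [← integral_const_mul]
  exact integral_mono_ae hE2 (hE1.const_mul _) hle

lemma Constrained.le_actionL (hκ : 0 < κ) (hω : ω ∈ Ioo (π / 2) π)
    (hC : Constrained κ ω q a f g) :
    (1 - 2 * (q / Real.sin ω) ^ 2) * ∫ r in Ioi (0 : ℝ), calE1 κ a f r ≤ actionL κ a f g := by
  rw [actionL, integral_sub (hC.1.integrableOn_calE1 hκ) (hC.1.integrableOn_calE2 hκ)]
  linarith [hC.integral_calE2_le_mul hκ hω]

end Energy

section Competitor

lemma LocAC.of_hasDerivAt {h H : ℝ → ℝ} (hd : ∀ r, 0 ≤ r → HasDerivAt h (H r) r)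
    (hc : ContinuousOn H (Ioi 0)) : LocAC h :=
  ⟨fun r hr => (hd r hr).continuousAt.continuousWithinAt,
    (IsPrimitive.of_hasDerivAt (fun r hr => hd r (le_of_lt hr)) hc).locACIoi⟩

lemma exists_constrained {κ ω q : ℝ} (hκ : 0 < κ) (hω : ω ∈ Ioo (π / 2) π) (hq : 0 < q) :
    ∃ a f g : ℝ → ℝ, Constrained κ ω q a f g := by
  set p := π - ω with hp
  have hp0 : 0 < p := by linarith [hω.2]
  have hd1 : ∀ r : ℝ, 0 ≤ r → HasDerivAt (fun r : ℝ => (1 + r)⁻¹) (-((1 + r)⁻¹) ^ 2) r := by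
    intro r hr
    have h1 : (1 + r) ≠ 0 := by positivity
    refine (((hasDerivAt_id r).const_add 1).inv h1).congr_deriv ?_
    simp [div_eq_mul_inv]
  have hd2 : ∀ r : ℝ, 0 ≤ r →
      HasDerivAt (fun r : ℝ => p * (1 - (1 + r)⁻¹)) (p * ((1 + r)⁻¹) ^ 2) r := by
    intro r hr
    refine (((hd1 r hr).const_sub 1).const_mul p).congr_deriv ?_
    ring
  have hinv : ContinuousOn (fun r : ℝ => (1 + r)⁻¹) (Ioi 0) := fun r hr =>
    (hd1 r (le_of_lt hr)).continuousAt.continuousWithinAt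
  have hla := LocAC.of_hasDerivAt hd1 (hinv.pow 2).neg
  have hlf := LocAC.of_hasDerivAt hd2 ((hinv.pow 2).const_mul p)
  have hlim : Tendsto (fun r : ℝ => (1 + r)⁻¹) atTop (𝓝 0) :=
    tendsto_inv_atTop_zero.comp (tendsto_atTop_add_const_left _ _ tendsto_id)
  have hI : IntegrableOn (fun r : ℝ => (1 + r ^ 2)⁻¹) (Ioi 0) :=
    integrable_inv_one_add_sq.integrableOn
  have hsq : ∀ r : ℝ, 0 < r → ((1 + r)⁻¹) ^ 2 ≤ (1 + r ^ 2)⁻¹ := fun r hr => by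
    rw [inv_pow]; gcongr; nlinarith
  have ha2 : MemLp (fun r : ℝ => (1 + r)⁻¹) 2 μ₊ := by
    refine memLp_two_of_sq_le (hinv.aestronglyMeasurable measurableSet_Ioi) hI ?_
    filter_upwards [ae_restrict_mem measurableSet_Ioi] with r hr using hsq r hr
  obtain ⟨g, hg⟩ := exists_isPotential hla.1 ha2 hq
  refine ⟨_, _, g, Constrained.of_isPotential hla hlf (by simp) (by simp) hlim ?_ ?_ hg⟩
  · simpa using (hlim.const_sub 1).const_mul p
  refine Integrable.mono' (hI.const_mul (13 + 2 * p ^ 2 + 6 * κ * p ^ 2))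
    (aestronglyMeasurable_calE1 hla.continuousOn_Ioi hlf.continuousOn_Ioi) ?_
  filter_upwards [ae_restrict_mem measurableSet_Ioi] with r hr
  have hr : 0 < r := hr
  rw [Real.norm_eq_abs, abs_of_nonneg (calE1_nonneg hκ _ _ r)]
  refine le_trans ?_ (mul_le_mul_of_nonneg_left (hsq r hr) (by positivity))
  rw [calE1, (hd1 r hr.le).deriv, (hd2 r hr.le).deriv]
  set x := (1 + r)⁻¹ with hx
  have hx0 : 0 < x := by positivity
  have hx1 : x ≤ 1 := inv_le_one_of_one_le₀ (by linarith)
  have hxr : r * x = 1 - x := by rw [hx]; field_simp; ring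
  have hs1 : Real.sin (p * (1 - x)) ^ 2 ≤ 1 := Real.sin_sq_le_one _
  have hs2 : Real.sin (p * (1 - x)) ^ 2 / r ^ 2 ≤ p ^ 2 := by
    rw [div_le_iff₀ (by positivity), ← hxr]
    have h1 := Real.sin_sq_le_sq (x := p * (r * x))
    calc _ ≤ (p * (r * x)) ^ 2 := h1
      _ = p ^ 2 * r ^ 2 * x ^ 2 := by ring
      _ ≤ p ^ 2 * r ^ 2 * 1 := by gcongr; exact pow_le_one₀ hx0.le hx1
      _ = _ := by ring
  set S := Real.sin (p * (1 - x)) ^ 2 with hS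
  have hS0 : 0 ≤ S := sq_nonneg _
  have hx2 : x ^ 2 ≤ 1 := pow_le_one₀ hx0.le hx1
  have t1 : (-x ^ 2) ^ 2 ≤ x ^ 2 := by nlinarith
  have t2 : (x ^ 2 - 1) ^ 2 / r ^ 2 ≤ 4 * x ^ 2 := by
    rw [div_le_iff₀ (by positivity)]
    calc (x ^ 2 - 1) ^ 2 = (1 - x) ^ 2 * (1 + x) ^ 2 := by ring
      _ ≤ (1 - x) ^ 2 * 2 ^ 2 := by gcongr; linarith
      _ = _ := by rw [← hxr]; ring
  have t3 : r ^ 2 * (p * x ^ 2) ^ 2 ≤ p ^ 2 * x ^ 2 := by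
    calc r ^ 2 * (p * x ^ 2) ^ 2 = p ^ 2 * x ^ 2 * (r * x) ^ 2 := by ring
      _ ≤ p ^ 2 * x ^ 2 * 1 := by
          gcongr; rw [hxr]; exact pow_le_one₀ (by linarith) (by linarith)
      _ = _ := mul_one _
  have t4 : 2 * x ^ 2 * S ≤ 2 * x ^ 2 := by nlinarith
  have t5 : 2 * (p * x ^ 2) ^ 2 + x ^ 2 * S / r ^ 2 ≤ 3 * p ^ 2 := by
    have h1 : (p * x ^ 2) ^ 2 ≤ p ^ 2 := by
      calc (p * x ^ 2) ^ 2 ≤ (p * 1) ^ 2 := by gcongr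
        _ = _ := by ring
    have h2 : x ^ 2 * S / r ^ 2 ≤ p ^ 2 := by
      calc x ^ 2 * S / r ^ 2 = x ^ 2 * (S / r ^ 2) := by ring
        _ ≤ 1 * p ^ 2 := by gcongr
        _ = _ := one_mul _
    linarith
  have t6 : 2 * κ * x ^ 2 * S * (2 * (p * x ^ 2) ^ 2 + x ^ 2 * S / r ^ 2)
      ≤ 2 * κ * x ^ 2 * 1 * (3 * p ^ 2) := by gcongr
  nlinarith [mul_nonneg (sq_nonneg p) (sq_nonneg x)]

end Competitor

/-- Pairs with the boundary values of the admissible class and `∫ 𝓔₁ ≤ C`. -/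
structure BoundedEnergy (κ ω C : ℝ) (a f : ℝ → ℝ) : Prop where
  locAC_a : LocAC a
  locAC_f : LocAC f
  a_zero : a 0 = 1
  f_zero : f 0 = 0
  f_infty : Tendsto f atTop (𝓝 (π - ω))
  integrableOn : IntegrableOn (calE1 κ a f) (Ioi 0)
  integral_le : ∫ r in Ioi (0 : ℝ), calE1 κ a f r ≤ C

lemma exists_radius_sq_sin_gt (C : ℝ) {ω c : ℝ} (hc : c < Real.sin ω ^ 2) :
    ∃ R, 0 < R ∧ ∀ x, (x - (π - ω)) ^ 2 ≤ R⁻¹ * (2 * C) → c < Real.sin x ^ 2 := by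
  have h1 : ∀ᶠ x in 𝓝 (π - ω), c < Real.sin x ^ 2 := by
    have : Tendsto (fun x => Real.sin x ^ 2) (𝓝 (π - ω)) (𝓝 (Real.sin (π - ω) ^ 2)) :=
      (Real.continuous_sin.pow 2).tendsto _
    rw [Real.sin_pi_sub] at this
    exact this.eventually (lt_mem_nhds hc)
  obtain ⟨ε, hε, hball⟩ := Metric.eventually_nhds_iff.1 h1
  have h2 : Tendsto (fun R : ℝ => R⁻¹ * (2 * C)) atTop (𝓝 0) := by
    simpa using tendsto_inv_atTop_zero.mul_const (2 * C)
  obtain ⟨R, hR, hR0⟩ := ((h2.eventually (gt_mem_nhds (show 0 < ε ^ 2 by positivity))).and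
    (eventually_gt_atTop 0)).exists
  refine ⟨R, hR0, fun x hx => hball ?_⟩
  rw [Real.dist_eq]
  exact abs_lt_of_sq_lt_sq (hx.trans_lt hR) hε.le

namespace BoundedEnergy

variable {κ ω C : ℝ} {a f : ℝ → ℝ}

lemma C_nonneg (hκ : 0 < κ) (h : BoundedEnergy κ ω C a f) : 0 ≤ C :=
  (setIntegral_nonneg measurableSet_Ioi fun r _ => calE1_nonneg hκ a f r).trans h.integral_le

lemma memLp_of_le (h : BoundedEnergy κ ω C a f) {x : ℝ → ℝ} (hx : AEStronglyMeasurable x μ₊)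
    {D : ℝ} (hD : 0 ≤ D) (hle : ∀ r, x r ^ 2 ≤ D * calE1 κ a f r) :
    MemLp x 2 μ₊ ∧ ∫ r in Ioi (0 : ℝ), x r ^ 2 ≤ D * C := by
  have hm := memLp_two_of_sq_le hx (h.integrableOn.const_mul D) (ae_of_all _ hle)
  refine ⟨hm, (integral_mono hm.integrable_sq (h.integrableOn.const_mul D) hle).trans ?_⟩
  rw [integral_const_mul]
  exact mul_le_mul_of_nonneg_left h.integral_le hD

lemma memLp_deriv (hκ : 0 < κ) (h : BoundedEnergy κ ω C a f) :
    MemLp (deriv a) 2 μ₊ ∧ ∫ r in Ioi (0 : ℝ), deriv a r ^ 2 ≤ C := by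
  have := h.memLp_of_le (measurable_deriv a).aestronglyMeasurable zero_le_one
    fun r => by rw [one_mul]; exact sq_deriv_le_calE1 hκ a f r
  rwa [one_mul] at this

lemma memLp_mul_deriv (hκ : 0 < κ) (h : BoundedEnergy κ ω C a f) :
    MemLp (fun r => r * deriv f r) 2 μ₊ ∧ ∫ r in Ioi (0 : ℝ), (r * deriv f r) ^ 2 ≤ 2 * C :=
  h.memLp_of_le (x := fun r => r * deriv f r)
    (measurable_id.mul (measurable_deriv f)).aestronglyMeasurable zero_le_two
    fun r => by nlinarith [sq_mul_deriv_le_calE1 hκ a f r, sq_nonneg (a r * sin (f r))]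

lemma memLp_mul_sin (hκ : 0 < κ) (h : BoundedEnergy κ ω C a f) :
    MemLp (fun r => a r * Real.sin (f r)) 2 μ₊ ∧
      ∫ r in Ioi (0 : ℝ), (a r * Real.sin (f r)) ^ 2 ≤ C := by
  have := h.memLp_of_le (x := fun r => a r * Real.sin (f r))
    ((h.locAC_a.continuousOn_Ioi.aestronglyMeasurable measurableSet_Ioi).mul
      (aestronglyMeasurable_comp_sin h.locAC_f.continuousOn_Ioi)) zero_le_one
    fun r => by nlinarith [sq_mul_deriv_le_calE1 hκ a f r, sq_nonneg (r * deriv f r)]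
  rwa [one_mul] at this

lemma sq_sub_one_le (hκ : 0 < κ) (h : BoundedEnergy κ ω C a f) {r : ℝ} (hr : 0 < r) :
    (a r - 1) ^ 2 ≤ r * C := by
  obtain ⟨h1, h2⟩ := h.memLp_deriv hκ
  rw [← h.a_zero]
  exact (h.locAC_a.isPrimitive.sq_sub_zero_le h1 h.locAC_a.1 hr).trans (by gcongr)

lemma sq_sub_limit_le (hκ : 0 < κ) (h : BoundedEnergy κ ω C a f) {r : ℝ} (hr : 0 < r) :
    (f r - (π - ω)) ^ 2 ≤ r⁻¹ * (2 * C) := by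
  obtain ⟨h1, h2⟩ := h.memLp_mul_deriv hκ
  exact (h.locAC_f.isPrimitive.sq_sub_limit_le h1 h.f_infty hr).trans (by gcongr)

lemma sq_cos_sub_one_le (hκ : 0 < κ) (h : BoundedEnergy κ ω C a f) {r : ℝ} (hr : 0 < r) :
    (Real.cos (f r) - 1) ^ 2 ≤ r * ((κ⁻¹ + 2 * (4 * (C + 1)) ^ 2) * C) := by
  have hC := h.C_nonneg hκ
  obtain ⟨δ, hδ, hδC⟩ : ∃ δ, 0 < δ ∧ δ * (4 * (C + 1)) = 1 :=
    ⟨(4 * (C + 1))⁻¹, by positivity, inv_mul_cancel₀ (by positivity)⟩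
  have hm : AEStronglyMeasurable (fun r => -Real.sin (f r) * deriv f r) μ₊ :=
    (aestronglyMeasurable_comp_sin h.locAC_f.continuousOn_Ioi).neg.mul
      (measurable_deriv f).aestronglyMeasurable
  have hle : ∀ r, 0 < r → (-Real.sin (f r) * deriv f r) ^ 2 ≤
      (κ⁻¹ + 2 * (4 * (C + 1)) ^ 2) * calE1 κ a f r := by
    intro r hr
    have hE := calE1_nonneg hκ a f r
    rcases le_or_gt r δ with hrδ | hrδ
    · have ha : 1 / 4 ≤ a r ^ 2 := by
        have h1 : (a r - 1) ^ 2 ≤ 1 / 4 := by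
          refine (h.sq_sub_one_le hκ hr).trans ?_
          nlinarith
        have h2 := abs_le_of_sq_le_sq (a := a r - 1) (b := 1 / 2) (by linarith) (by norm_num)
        have h3 := abs_le.1 h2
        nlinarith
      have h2 := sq_cross_le_calE1 hκ a f r
      have h3 : (-Real.sin (f r) * deriv f r) ^ 2 ≤ κ⁻¹ * calE1 κ a f r := by
        rw [inv_mul_eq_div, le_div_iff₀ hκ]
        calc _ = 4 * κ * ((Real.sin (f r) * deriv f r) ^ 2 * (1 / 4)) := by ring
          _ ≤ 4 * κ * ((Real.sin (f r) * deriv f r) ^ 2 * a r ^ 2) := by gcongr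
          _ = 4 * κ * (a r * sin (f r) * deriv f r) ^ 2 := by ring
          _ ≤ _ := h2
      nlinarith [mul_nonneg (sq_nonneg (4 * (C + 1))) hE]
    · have h1 : 1 ≤ (r * (4 * (C + 1))) ^ 2 :=
        one_le_pow₀ (hδC.symm.le.trans (by gcongr))
      have h2 := sq_mul_deriv_le_calE1 hκ a f r
      have h3 : (-Real.sin (f r) * deriv f r) ^ 2 ≤ 2 * (4 * (C + 1)) ^ 2 * calE1 κ a f r := by
        calc _ = Real.sin (f r) ^ 2 * (deriv f r ^ 2 * 1) := by ring
          _ ≤ 1 * (deriv f r ^ 2 * (r * (4 * (C + 1))) ^ 2) := by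
              gcongr; exact Real.sin_sq_le_one _
          _ = (4 * (C + 1)) ^ 2 * (r * deriv f r) ^ 2 := by ring
          _ ≤ (4 * (C + 1)) ^ 2 * (2 * calE1 κ a f r) := by
              gcongr; nlinarith [sq_nonneg (a r * sin (f r))]
          _ = _ := by ring
      have : 0 ≤ κ⁻¹ * calE1 κ a f r := by positivity
      nlinarith
  have hle' : ∀ᵐ r ∂μ₊, (-Real.sin (f r) * deriv f r) ^ 2 ≤
      (κ⁻¹ + 2 * (4 * (C + 1)) ^ 2) * calE1 κ a f r := by
    filter_upwards [ae_restrict_mem measurableSet_Ioi] with r hr using hle r hr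
  have hi := h.integrableOn.const_mul (κ⁻¹ + 2 * (4 * (C + 1)) ^ 2)
  have hmem := memLp_two_of_sq_le hm hi hle'
  have h1 := h.locAC_f.isPrimitive.cos.sq_sub_zero_le hmem
    (Real.continuous_cos.comp_continuousOn h.locAC_f.1) hr
  rw [h.f_zero, Real.cos_zero] at h1
  refine h1.trans (mul_le_mul_of_nonneg_left ?_ hr.le)
  refine (integral_mono_ae hmem.integrable_sq hi hle').trans ?_
  rw [integral_const_mul]
  exact mul_le_mul_of_nonneg_left h.integral_le (by positivity)

lemma sq_le_near_zero (hκ : 0 < κ) (h : BoundedEnergy κ ω C a f) {D : ℝ}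
    (hD : D = (κ⁻¹ + 2 * (4 * (C + 1)) ^ 2) * C) {r : ℝ} (hr : 0 < r) (hrD : r * D < 1) :
    f r ^ 2 ≤ π ^ 2 / 2 * √(r * D) := by
  have hC := h.C_nonneg hκ
  have hD0 : 0 ≤ D := by rw [hD]; positivity
  have hcos : ∀ y ∈ Ioc 0 r, 0 < Real.cos (f y) := by
    intro y hy
    have h1 := h.sq_cos_sub_one_le hκ hy.1
    rw [← hD] at h1
    have h2 : y * D ≤ r * D := by gcongr; exact hy.2
    by_contra! hneg
    nlinarith
  have hpi := Real.pi_pos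
  have hcont : ContinuousOn f (Icc 0 r) := h.locAC_f.1.mono Icc_subset_Ici_self
  have hne : ∀ x, Real.cos x = 0 → ∀ y ∈ Icc 0 r, f y ≠ x := by
    intro x hx y hy hyx
    rcases eq_or_lt_of_le hy.1 with h0 | h0
    · rw [← h0, h.f_zero] at hyx
      rw [← hyx] at hx; simp at hx
    · have := hcos y ⟨h0, hy.2⟩
      rw [hyx, hx] at this; exact this.false
  have habs : |f r| ≤ π := by
    rw [abs_le]
    constructor <;> by_contra! hneg
    · obtain ⟨y, hy, hyx⟩ := intermediate_value_Icc' hr.le hcont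
        (show -(π / 2) ∈ Icc (f r) (f 0) from ⟨by linarith, by rw [h.f_zero]; linarith⟩)
      exact hne _ (by simp) y hy hyx
    · obtain ⟨y, hy, hyx⟩ := intermediate_value_Icc hr.le hcont
        (show π / 2 ∈ Icc (f 0) (f r) from ⟨by rw [h.f_zero]; linarith, by linarith⟩)
      exact hne _ (by simp) y hy hyx
  have h1 := Real.cos_le_one_sub_mul_cos_sq habs
  have h2 : 1 - Real.cos (f r) ≤ √(r * D) := by
    refine Real.le_sqrt_of_sq_le ?_
    have := h.sq_cos_sub_one_le hκ hr
    rw [← hD] at this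
    linarith [sub_sq_comm (1 : ℝ) (Real.cos (f r))]
  have h3 : 2 / π ^ 2 * f r ^ 2 ≤ √(r * D) := by linarith
  calc f r ^ 2 = π ^ 2 / 2 * (2 / π ^ 2 * f r ^ 2) := by field_simp
    _ ≤ _ := by gcongr

lemma abs_apply_le (hκ : 0 < κ) (h : BoundedEnergy κ ω C a f) {r R : ℝ} (hr : 0 < r) (hrR : r ≤ R) :
    |a r| ≤ 1 + √(R * C) := by
  have hC := h.C_nonneg hκ
  have h1 : |a r - 1| ≤ √(R * C) := by
    rw [← Real.sqrt_sq_eq_abs]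
    exact Real.sqrt_le_sqrt ((h.sq_sub_one_le hκ hr).trans (by gcongr))
  calc |a r| = |1 + (a r - 1)| := by ring_nf
    _ ≤ |1| + |a r - 1| := abs_add_le _ _
    _ ≤ _ := by rw [abs_one]; gcongr

lemma memLp_self (hκ : 0 < κ) (h : BoundedEnergy κ ω C a f) {c R : ℝ} (hc : 0 < c) (hR : 0 < R)
    (hs : ∀ r, R ≤ r → c < Real.sin (f r) ^ 2) :
    MemLp a 2 μ₊ ∧ ∫ r in Ioi (0 : ℝ), a r ^ 2 ≤ R * (1 + √(R * C)) ^ 2 + c⁻¹ * C := by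
  obtain ⟨h1, h2⟩ := h.memLp_mul_sin hκ
  have i0 : Integrable ((Ioc 0 R).indicator fun _ => (1 + √(R * C)) ^ 2) μ₊ :=
    ((integrable_indicator_iff measurableSet_Ioc).2
      (integrableOn_const (measure_Ioc_lt_top).ne)).mono_measure Measure.restrict_le_self
  have i1 := h1.integrable_sq.const_mul c⁻¹
  have hle : ∀ᵐ r ∂μ₊, a r ^ 2 ≤ (Ioc 0 R).indicator (fun _ => (1 + √(R * C)) ^ 2) r
      + c⁻¹ * (a r * Real.sin (f r)) ^ 2 := by
    filter_upwards [ae_restrict_mem measurableSet_Ioi] with r hr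
    have hr : 0 < r := hr
    rcases le_or_gt r R with hrR | hrR
    · rw [indicator_of_mem (show r ∈ Ioc 0 R from ⟨hr, hrR⟩)]
      have h3 : a r ^ 2 ≤ (1 + √(R * C)) ^ 2 := by
        rw [← sq_abs (a r)]; gcongr; exact h.abs_apply_le hκ hr hrR
      have : 0 ≤ c⁻¹ * (a r * Real.sin (f r)) ^ 2 := by positivity
      linarith
    · rw [indicator_of_notMem (fun h => absurd h.2 (not_le.2 hrR)), zero_add, inv_mul_eq_div,
        le_div_iff₀ hc, mul_pow]
      gcongr
      exact (hs r hrR.le).le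
  have i2 : Integrable (fun r => (Ioc 0 R).indicator (fun _ => (1 + √(R * C)) ^ 2) r
      + c⁻¹ * (a r * Real.sin (f r)) ^ 2) μ₊ := i0.add i1
  have hm := memLp_two_of_sq_le
    (h.locAC_a.continuousOn_Ioi.aestronglyMeasurable measurableSet_Ioi) i2 hle
  refine ⟨hm, (integral_mono_ae hm.integrable_sq i2 hle).trans ?_⟩
  rw [integral_add i0 i1, integral_indicator measurableSet_Ioc, restrict_halfLine
    Ioc_subset_Ioi_self measurableSet_Ioc, integral_const_mul]
  have : 0 < c⁻¹ := by positivity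
  have h5 : ∫ _ in Ioc 0 R, (1 + √(R * C)) ^ 2 = R * (1 + √(R * C)) ^ 2 := by
    simp [hR.le]
  rw [h5]
  gcongr

end BoundedEnergy

lemma WeakTendsto.congr_limit {α : Type*} [MeasurableSpace α] {μ : Measure α} {x : ℕ → α → ℝ}
    {X Y : α → ℝ} (h : WeakTendsto μ x X) (hXY : X =ᵐ[μ] Y) : WeakTendsto μ x Y :=
  ⟨h.memLp, h.memLp_limit.ae_eq hXY, h.bounded, fun y hy => by
    rw [show ∫ a, Y a * y a ∂μ = ∫ a, X a * y a ∂μ from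
      integral_congr_ae (hXY.symm.mul (ae_eq_refl y))]
    exact h.tendsto y hy⟩

lemma WeakTendsto.tendsto_intervalIntegral_zero {x : ℕ → ℝ → ℝ} {X : ℝ → ℝ}
    (h : WeakTendsto μ₊ x X) {t : ℝ} (ht : 0 < t) :
    Tendsto (fun n => ∫ r in (0 : ℝ)..t, x n r) atTop (𝓝 (∫ r in (0 : ℝ)..t, X r)) := by
  have h1 := h.restrict (measurableSet_Ioc (a := 0) (b := t))
  rw [restrict_halfLine Ioc_subset_Ioi_self measurableSet_Ioc] at h1
  simpa only [mul_one, intervalIntegral.integral_of_le ht.le] using h1.tendsto (fun _ => 1) (memLp_const 1)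

lemma WeakTendsto.tendsto_integral_div_Ioi {x : ℕ → ℝ → ℝ} {X : ℝ → ℝ}
    (h : WeakTendsto μ₊ x X) {t : ℝ} (ht : 0 < t) :
    Tendsto (fun n => ∫ r in Ioi t, x n r / r) atTop (𝓝 (∫ r in Ioi t, X r / r)) := by
  have h1 := h.restrict (measurableSet_Ioi (a := t))
  rw [restrict_halfLine (Ioi_subset_Ioi ht.le) measurableSet_Ioi] at h1
  simpa only [div_eq_mul_inv] using h1.tendsto _ (memLp_inv_Ioi ht)

lemma memLp_two_of_tendsto {μ : Measure ℝ} {x : ℕ → ℝ → ℝ} {X : ℝ → ℝ}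
    (hx : ∀ n, MemLp (x n) 2 μ) {C : ℝ} (hC : ∀ n, ∫ a, x n a ^ 2 ∂μ ≤ C)
    (h : ∀ᵐ a ∂μ, Tendsto (fun n => x n a) atTop (𝓝 (X a))) : MemLp X 2 μ := by
  have hm := aestronglyMeasurable_of_tendsto_ae atTop (fun n => (hx n).1) h
  rw [memLp_two_iff_integrable_sq hm]
  have h2 : ∀ᵐ a ∂μ, Tendsto (fun n => x n a ^ 2) atTop (𝓝 (X a ^ 2)) := by
    filter_upwards [h] with a ha using ha.pow 2
  have hle : ∀ n, ∫⁻ a, ‖x n a ^ 2‖ₑ ∂μ ≤ ENNReal.ofReal C := fun n => by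
    rw [← ofReal_integral_norm_eq_lintegral_enorm (hx n).integrable_sq]
    refine ENNReal.ofReal_le_ofReal ?_
    simpa using hC n
  refine ⟨hm.pow 2, (lintegral_enorm_le_liminf_of_tendsto h2
    fun n => ((hx n).1.pow 2).aemeasurable.enorm).trans_lt ?_⟩
  exact ((liminf_le_liminf (Eventually.of_forall hle)).trans_eq
    (liminf_const _)).trans_lt ENNReal.ofReal_lt_top

lemma IsPrimitive.tendsto_zero {h H : ℝ → ℝ} (hh : IsPrimitive h H) (hh2 : MemLp h 2 μ₊)
    (hH : MemLp H 2 μ₊) : Tendsto h atTop (𝓝 0) := by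
  have hs : ∀ {t : ℝ}, 0 < t → Ioc t (t + 1) ⊆ Ioi 0 := fun ht _ hr => ht.trans hr.1
  have hle : ∀ t, 0 < t →
      h t ^ 2 ≤ 2 * ((∫ r in Ioc t (t + 1), h r ^ 2) + ∫ r in Ioc t (t + 1), H r ^ 2) := by
    intro t ht
    have i1 := integrableOn_sq_of_halfLine hh2 (hs ht)
    have h1 : ∀ s ∈ Ioc t (t + 1), h t ^ 2 ≤ 2 * h s ^ 2 + 2 * ∫ r in Ioc t (t + 1), H r ^ 2 := by
      intro s hs'
      have hsub : Ioc t s ⊆ Ioc t (t + 1) := Ioc_subset_Ioc_right hs'.2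
      have h2 := sq_intervalIntegral_le hs'.1.le
        (memLp_restrict_of_halfLine hH (hsub.trans (hs ht)))
      rw [← (hh t s ht hs'.1.le).2] at h2
      have h3 : ∫ r in Ioc t s, H r ^ 2 ≤ ∫ r in Ioc t (t + 1), H r ^ 2 :=
        setIntegral_mono_set (integrableOn_sq_of_halfLine hH (hs ht))
          (Eventually.of_forall fun _ => sq_nonneg _) (LE.le.eventuallyLE hsub)
      have h4 : 0 ≤ ∫ r in Ioc t s, H r ^ 2 := integral_nonneg fun _ => sq_nonneg _
      have h5 : (s - t) * ∫ r in Ioc t s, H r ^ 2 ≤ 1 * ∫ r in Ioc t (t + 1), H r ^ 2 :=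
        mul_le_mul (by linarith [hs'.2]) h3 h4 zero_le_one
      nlinarith [sq_nonneg (h s + (h s - h t))]
    have h6 : ∫ _ in Ioc t (t + 1), h t ^ 2 ≤
        ∫ s in Ioc t (t + 1), (2 * h s ^ 2 + 2 * ∫ r in Ioc t (t + 1), H r ^ 2) :=
      setIntegral_mono_on (integrableOn_const measure_Ioc_lt_top.ne)
        ((i1.const_mul 2).add (integrableOn_const measure_Ioc_lt_top.ne)) measurableSet_Ioc h1
    rw [integral_add (i1.const_mul 2) (integrableOn_const measure_Ioc_lt_top.ne),
      integral_const_mul] at h6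
    simp only [integral_const, MeasurableSet.univ, measureReal_restrict_apply, univ_inter,
      Real.volume_real_Ioc_of_le (by linarith : t ≤ t + 1), add_sub_cancel_left, one_smul] at h6
    linarith
  have hlim : ∀ {u : ℝ → ℝ}, MemLp u 2 μ₊ →
      Tendsto (fun t => ∫ r in Ioc t (t + 1), u r ^ 2) atTop (𝓝 0) := by
    intro u hu
    have hi : IntegrableOn (fun r => u r ^ 2) (Ioi 0) := hu.integrable_sq
    have h1 := intervalIntegral_tendsto_integral_Ioi 0 hi tendsto_id
    have h2 := intervalIntegral_tendsto_integral_Ioi 0 hi (tendsto_atTop_add_const_right _ 1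
      tendsto_id)
    have h3 := h2.sub h1
    rw [sub_self] at h3
    refine h3.congr' ?_
    filter_upwards [eventually_gt_atTop 0] with t ht
    have hint : ∀ {s : ℝ}, 0 ≤ s → IntervalIntegrable (fun r => u r ^ 2) volume 0 s := fun hs =>
      (intervalIntegrable_iff_integrableOn_Ioc_of_le hs).2 (hi.mono_set Ioc_subset_Ioi_self)
    simp only [id]
    rw [intervalIntegral.integral_interval_sub_left (hint (by linarith)) (hint ht.le),
      intervalIntegral.integral_of_le (by linarith)]
  have h7 : Tendsto (fun t => h t ^ 2) atTop (𝓝 0) := by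
    refine squeeze_zero' (Eventually.of_forall fun _ => sq_nonneg _)
      ((eventually_gt_atTop 0).mono hle) ?_
    simpa using ((hlim hh2).add (hlim hH)).const_mul 2
  rw [tendsto_zero_iff_abs_tendsto_zero]
  simpa [Function.comp_def, Real.sqrt_sq_eq_abs] using h7.sqrt

/-- Locally uniform and weak energy convergence of a sequence of pairs, to a pair satisfying the
boundary conditions. -/
structure EnergyTendsto (ω : ℝ) (a f : ℕ → ℝ → ℝ) (b k : ℝ → ℝ) : Prop where
  locAC_a : LocAC b
  locAC_f : LocAC k
  a_zero : b 0 = 1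
  f_zero : k 0 = 0
  a_infty : Tendsto b atTop (𝓝 0)
  f_infty : Tendsto k atTop (𝓝 (π - ω))
  memLp_a : MemLp b 2 μ₊
  tendsto_a : ∀ r, 0 < r → Tendsto (fun n => a n r) atTop (𝓝 (b r))
  tendsto_f : ∀ r, 0 < r → Tendsto (fun n => f n r) atTop (𝓝 (k r))
  weak_a : WeakTendsto μ₊ (fun n => deriv (a n)) (deriv b)
  weak_f : WeakTendsto μ₊ (fun n r => r * deriv (f n) r) (fun r => r * deriv k r)

lemma exists_energyTendsto {κ ω C c : ℝ} (hκ : 0 < κ) (hc : 0 < c) (hcω : c < Real.sin ω ^ 2)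
    {a f : ℕ → ℝ → ℝ} (h : ∀ n, BoundedEnergy κ ω C (a n) (f n)) :
    ∃ φ : ℕ → ℕ, StrictMono φ ∧ ∃ b k,
      EnergyTendsto ω (fun n => a (φ n)) (fun n => f (φ n)) b k := by
  have : Fact ((2 : ENNReal) ≠ ⊤) := ⟨by norm_num⟩
  obtain ⟨φ, hφ, A, hA⟩ := exists_weakTendsto_subseq (fun n => ((h n).memLp_deriv hκ).1)
    (fun n => ((h n).memLp_deriv hκ).2)
  obtain ⟨ψ, hψ, F, hF⟩ := exists_weakTendsto_subseq (fun n => ((h (φ n)).memLp_mul_deriv hκ).1)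
    (fun n => ((h (φ n)).memLp_mul_deriv hκ).2)
  have hA := hA.comp_subseq hψ
  set b : ℝ → ℝ := fun t => 1 + ∫ r in (0 : ℝ)..t, A r with hb
  set k : ℝ → ℝ := fun t => if 0 < t then (π - ω) - ∫ r in Ioi t, F r / r else 0 with hk
  have hkpos : ∀ t, 0 < t → (π - ω) - ∫ r in Ioi t, F r / r = k t := fun t ht => (if_pos ht).symm
  have hb0 : b 0 = 1 := by simp [hb]
  have hk0 : k 0 = 0 := if_neg (lt_irrefl 0)
  have hbp : IsPrimitive b A := isPrimitive_integral_zero hA.memLp_limit 1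
  have hkp : IsPrimitive k (fun r => F r / r) := (isPrimitive_tail hF.memLp_limit _).congr hkpos
  have hta : ∀ r, 0 < r → Tendsto (fun n => a (φ (ψ n)) r) atTop (𝓝 (b r)) := fun r hr => by
    refine ((hA.tendsto_intervalIntegral_zero hr).const_add 1).congr fun n => ?_
    have := (h (φ (ψ n))).locAC_a
    rw [this.isPrimitive.eq_integral_zero (hA.memLp n) this.1 hr, (h (φ (ψ n))).a_zero]
  have htf : ∀ r, 0 < r → Tendsto (fun n => f (φ (ψ n)) r) atTop (𝓝 (k r)) := fun r hr => by
    rw [← hkpos r hr]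
    refine ((hF.tendsto_integral_div_Ioi hr).const_sub (π - ω)).congr fun n => ?_
    rw [(h (φ (ψ n))).locAC_f.isPrimitive.eq_sub_tail (hF.memLp n) (h (φ (ψ n))).f_infty hr]
  have hbL : MemLp b 2 μ₊ := by
    obtain ⟨R, hR, hRs⟩ := exists_radius_sq_sin_gt C hcω
    have hs : ∀ n r, R ≤ r → c < Real.sin (f n r) ^ 2 := fun n r hr => hRs _ <|
      ((h n).sq_sub_limit_le hκ (hR.trans_le hr)).trans <| mul_le_mul_of_nonneg_right
        (inv_anti₀ hR hr) (mul_nonneg zero_le_two ((h n).C_nonneg hκ))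
    exact memLp_two_of_tendsto (fun n => ((h (φ (ψ n))).memLp_self hκ hc hR (hs _)).1)
      (fun n => ((h (φ (ψ n))).memLp_self hκ hc hR (hs _)).2)
      ((ae_restrict_mem measurableSet_Ioi).mono hta)
  have hkt : Tendsto k (𝓝[>] 0) (𝓝 (k 0)) := by
    obtain ⟨D, hD⟩ : ∃ D, D = (κ⁻¹ + 2 * (4 * (C + 1)) ^ 2) * C := ⟨_, rfl⟩
    have h1 : Tendsto (fun r : ℝ => r * D) (𝓝[>] 0) (𝓝 0) :=
      ((continuous_mul_const D).tendsto' 0 0 (zero_mul D)).mono_left nhdsWithin_le_nhds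
    have h2 : Tendsto (fun r : ℝ => √(π ^ 2 / 2 * √(r * D))) (𝓝[>] 0) (𝓝 0) := by
      have := (h1.sqrt.const_mul (π ^ 2 / 2)).sqrt
      rwa [Real.sqrt_zero, mul_zero, Real.sqrt_zero] at this
    rw [hk0]
    refine squeeze_zero_norm' ?_ h2
    filter_upwards [h1.eventually (gt_mem_nhds zero_lt_one), self_mem_nhdsWithin] with r hrD hr
    refine Real.le_sqrt_of_sq_le ?_
    rw [Real.norm_eq_abs, sq_abs]
    exact le_of_tendsto ((htf r hr).pow 2)
      (Eventually.of_forall fun n => (h (φ (ψ n))).sq_le_near_zero hκ hD hr hrD)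
  refine ⟨fun n => φ (ψ n), hφ.comp hψ, b, k, ⟨continuousOn_integral_zero hA.memLp_limit 1,
    hbp.locACIoi⟩, ⟨continuousOn_Ici_of_tendsto hkp.continuousOn hkt, hkp.locACIoi⟩, hb0, hk0,
    hbp.tendsto_zero hbL hA.memLp_limit, ?_, hbL, hta, htf, hA.congr_limit hbp.deriv_ae_eq.symm,
    hF.congr_limit ?_⟩
  · refine (tendsto_tail hF.memLp_limit (π - ω)).congr' ?_
    filter_upwards [eventually_gt_atTop 0] with t ht using hkpos t ht
  · filter_upwards [hkp.deriv_ae_eq, ae_restrict_mem measurableSet_Ioi] with r hr hr0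
    rw [hr, mul_div_cancel₀ _ (ne_of_gt hr0)]

section LowerSemicontinuity

/-- The factor of `(r f')²` in `calE1`, in terms of the values `x = a r`, `s = f r`. -/
def gradCoeff (κ r x s : ℝ) : ℝ := 1 / 2 + 4 * κ * (x ^ 2 * Real.sin s ^ 2) / r ^ 2

/-- The derivative-free part of `calE1 κ a f r - 2 (a r)² y²`, with `x = a r`, `s = f r`. -/
def potentialPart (κ r x s y : ℝ) : ℝ :=
  2 * (x ^ 2 - 1) ^ 2 / r ^ 2 + x ^ 2 * Real.sin s ^ 2
    + 2 * κ * (x ^ 2 * Real.sin s ^ 2) ^ 2 / r ^ 2 - 2 * (x ^ 2 * y ^ 2)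

lemma calE1_sub_eq (κ : ℝ) (a f : ℝ → ℝ) {r : ℝ} (hr : r ≠ 0) (y : ℝ) :
    calE1 κ a f r - 2 * (a r ^ 2 * y ^ 2) = 4 * deriv a r ^ 2
      + gradCoeff κ r (a r) (f r) * (r * deriv f r) ^ 2 + potentialPart κ r (a r) (f r) y := by
  unfold calE1 gradCoeff potentialPart
  field_simp
  ring

lemma gradCoeff_nonneg {κ : ℝ} (hκ : 0 < κ) (r x s : ℝ) : 0 ≤ gradCoeff κ r x s := by
  unfold gradCoeff; positivity

lemma sq_mul_sin_sq_le {x B : ℝ} (hx : |x| ≤ B) (s : ℝ) : x ^ 2 * Real.sin s ^ 2 ≤ B ^ 2 := by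
  have h1 : x ^ 2 ≤ B ^ 2 := by rw [← sq_abs]; gcongr
  nlinarith [Real.sin_sq_le_one s, sq_nonneg x, sq_nonneg (Real.sin s)]

lemma abs_gradCoeff_le {κ ε r x B : ℝ} (hκ : 0 < κ) (hε : 0 < ε) (hr : ε ≤ r) (hx : |x| ≤ B)
    (s : ℝ) : |gradCoeff κ r x s| ≤ 1 / 2 + 4 * κ * B ^ 2 / ε ^ 2 := by
  rw [abs_of_nonneg (gradCoeff_nonneg hκ r x s)]
  unfold gradCoeff
  gcongr
  exact sq_mul_sin_sq_le hx s

lemma abs_potentialPart_le {κ ε r x y B q : ℝ} (hκ : 0 < κ) (hε : 0 < ε) (hr : ε ≤ r)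
    (hx : |x| ≤ B) (hy0 : 0 ≤ y) (hy : y ≤ q) (s : ℝ) :
    |potentialPart κ r x s y| ≤ 2 * (B ^ 2 + 1) ^ 2 / ε ^ 2 + B ^ 2
      + 2 * κ * (B ^ 2) ^ 2 / ε ^ 2 + 2 * (B ^ 2 * q ^ 2) := by
  have h1 : x ^ 2 ≤ B ^ 2 := by rw [← sq_abs]; gcongr
  have hs := sq_mul_sin_sq_le hx s
  have t1 : 2 * (x ^ 2 - 1) ^ 2 / r ^ 2 ≤ 2 * (B ^ 2 + 1) ^ 2 / ε ^ 2 := by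
    have : (x ^ 2 - 1) ^ 2 ≤ (B ^ 2 + 1) ^ 2 := by
      refine sq_le_sq' ?_ ?_ <;> nlinarith [sq_nonneg x, sq_nonneg B]
    gcongr
  have t2 : 2 * κ * (x ^ 2 * Real.sin s ^ 2) ^ 2 / r ^ 2 ≤ 2 * κ * (B ^ 2) ^ 2 / ε ^ 2 := by
    gcongr
  have t3 : 2 * (x ^ 2 * y ^ 2) ≤ 2 * (B ^ 2 * q ^ 2) := by gcongr
  have p1 : 0 ≤ 2 * (x ^ 2 - 1) ^ 2 / r ^ 2 := by positivity
  have p2 : 0 ≤ 2 * κ * (x ^ 2 * Real.sin s ^ 2) ^ 2 / r ^ 2 := by positivity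
  have p3 : 0 ≤ 2 * (x ^ 2 * y ^ 2) := by positivity
  have p4 : 0 ≤ x ^ 2 * Real.sin s ^ 2 := by positivity
  have p5 : 0 ≤ 2 * (B ^ 2 * q ^ 2) := by positivity
  unfold potentialPart
  rw [abs_le]
  constructor <;> linarith [sq_nonneg B]

variable {κ ω C q : ℝ} {a f : ℕ → ℝ → ℝ} {b k g : ℝ → ℝ}

lemma EnergyTendsto.setIntegral_le (hκ : 0 < κ) (h : EnergyTendsto ω a f b k)
    (hB : ∀ n, BoundedEnergy κ ω C (a n) (f n)) (hg : ContinuousOn g (Ioi 0))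
    (hgq : ∀ r, 0 < r → 0 ≤ g r ∧ g r ≤ q) {ε M : ℝ} (hε : 0 < ε) {l : ℕ → ℝ} {L : ℝ}
    (hl : ∀ n, ∫ r in Ioc ε M, (calE1 κ (a n) (f n) r - 2 * (a n r ^ 2 * g r ^ 2)) ≤ l n)
    (hL : Tendsto l atTop (𝓝 L)) :
    IntegrableOn (fun r => calE1 κ b k r - 2 * (b r ^ 2 * g r ^ 2)) (Ioc ε M) ∧
    ∫ r in Ioc ε M, (calE1 κ b k r - 2 * (b r ^ 2 * g r ^ 2)) ≤ L := by
  have hK : Ioc ε M ⊆ Ioi 0 := fun r hr => hε.trans hr.1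
  have hμ := restrict_halfLine hK measurableSet_Ioc
  set μ : Measure ℝ := volume.restrict (Ioc ε M) with hμdef
  have hmem : ∀ᵐ r ∂μ, r ∈ Ioc ε M := ae_restrict_mem measurableSet_Ioc
  have wa := h.weak_a.restrict (measurableSet_Ioc (a := ε) (b := M))
  have wf := h.weak_f.restrict (measurableSet_Ioc (a := ε) (b := M))
  rw [hμ] at wa wf
  set B := 1 + √(M * C)
  have hab : ∀ n r, r ∈ Ioc ε M → |a n r| ≤ B := fun n r hr =>
    (hB n).abs_apply_le hκ (hK hr) hr.2
  have ma : ∀ n, AEMeasurable (a n) μ := fun n =>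
    (((hB n).locAC_a.continuousOn_Ioi.mono hK).aestronglyMeasurable measurableSet_Ioc).aemeasurable
  have mf : ∀ n, AEMeasurable (f n) μ := fun n =>
    (((hB n).locAC_f.continuousOn_Ioi.mono hK).aestronglyMeasurable measurableSet_Ioc).aemeasurable
  have mg : AEMeasurable g μ :=
    ((hg.mono hK).aestronglyMeasurable measurableSet_Ioc).aemeasurable
  have mc : ∀ n, AEStronglyMeasurable (fun r => gradCoeff κ r (a n r) (f n r)) μ := fun n => by
    have := ma n; have := (Real.measurable_sin.comp_aemeasurable (mf n))
    refine AEMeasurable.aestronglyMeasurable ?_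
    simp only [Function.comp_def] at this
    unfold gradCoeff; fun_prop
  have mp : ∀ n, AEStronglyMeasurable (fun r => potentialPart κ r (a n r) (f n r) (g r)) μ :=
    fun n => by
      have := ma n; have := (Real.measurable_sin.comp_aemeasurable (mf n))
      refine AEMeasurable.aestronglyMeasurable ?_
      simp only [Function.comp_def] at this
      unfold potentialPart; fun_prop
  have bc : ∀ n, ∀ᵐ r ∂μ, |gradCoeff κ r (a n r) (f n r)| ≤ 1 / 2 + 4 * κ * B ^ 2 / ε ^ 2 :=
    fun n => hmem.mono fun r hr => abs_gradCoeff_le hκ hε hr.1.le (hab n r hr) _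
  have bp : ∀ n, ∀ᵐ r ∂μ, ‖potentialPart κ r (a n r) (f n r) (g r)‖ ≤
      2 * (B ^ 2 + 1) ^ 2 / ε ^ 2 + B ^ 2 + 2 * κ * (B ^ 2) ^ 2 / ε ^ 2 + 2 * (B ^ 2 * q ^ 2) :=
    fun n => hmem.mono fun r hr => abs_potentialPart_le hκ hε hr.1.le (hab n r hr)
      (hgq r (hK hr)).1 (hgq r (hK hr)).2 _
  have tc : ∀ᵐ r ∂μ, Tendsto (fun n => gradCoeff κ r (a n r) (f n r)) atTop
      (𝓝 (gradCoeff κ r (b r) (k r))) := hmem.mono fun r hr => by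
    have h1 := h.tendsto_a r (hK hr)
    have h2 := (Real.continuous_sin.tendsto _).comp (h.tendsto_f r (hK hr))
    exact ((((h1.pow 2).mul (h2.pow 2)).const_mul (4 * κ)).div_const _).const_add _
  have tp : ∀ᵐ r ∂μ, Tendsto (fun n => potentialPart κ r (a n r) (f n r) (g r)) atTop
      (𝓝 (potentialPart κ r (b r) (k r) (g r))) := hmem.mono fun r hr => by
    have h1 := h.tendsto_a r (hK hr)
    have h2 := (Real.continuous_sin.tendsto _).comp (h.tendsto_f r (hK hr))
    have h3 := (h1.pow 2).mul (h2.pow 2)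
    exact ((((((h1.pow 2).sub_const 1).pow 2).const_mul 2).div_const _).add h3 |>.add
      (((h3.pow 2).const_mul (2 * κ)).div_const _)).sub (((h1.pow 2).mul_const _).const_mul 2)
  obtain ⟨ia, ta⟩ := wa.tendsto_tangent (c := fun _ _ => 4) (c' := fun _ => 4) (B := 4)
    (fun _ => aestronglyMeasurable_const) (fun _ => ae_of_all _ fun _ => by norm_num)
    (ae_of_all _ fun _ => tendsto_const_nhds)
  obtain ⟨iF, tF⟩ := wf.tendsto_tangent mc bc tc
  have ip : ∀ n, Integrable (fun r => potentialPart κ r (a n r) (f n r) (g r)) μ := fun n =>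
    (integrable_const _).mono' (mp n) (bp n)
  have tP := tendsto_integral_of_dominated_convergence _ mp (integrable_const _) bp tp
  have i1 : Integrable (fun r => 4 * deriv b r ^ 2) μ := wa.memLp_limit.integrable_sq.const_mul 4
  have bc' : ∀ᵐ r ∂μ, ‖gradCoeff κ r (b r) (k r)‖ ≤ 1 / 2 + 4 * κ * B ^ 2 / ε ^ 2 := by
    filter_upwards [ae_all_iff.2 bc, tc] with r h1 h2
    exact le_of_tendsto h2.abs (Eventually.of_forall h1)
  have i2 : Integrable (fun r => gradCoeff κ r (b r) (k r) * (r * deriv k r) ^ 2) μ :=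
    wf.memLp_limit.integrable_sq.bdd_mul (aestronglyMeasurable_of_tendsto_ae atTop mc tc) bc'
  have bp' : ∀ᵐ r ∂μ, ‖potentialPart κ r (b r) (k r) (g r)‖ ≤
      2 * (B ^ 2 + 1) ^ 2 / ε ^ 2 + B ^ 2 + 2 * κ * (B ^ 2) ^ 2 / ε ^ 2 + 2 * (B ^ 2 * q ^ 2) := by
    filter_upwards [ae_all_iff.2 bp, tp] with r h1 h2
    exact le_of_tendsto h2.norm (Eventually.of_forall h1)
  have i3 : Integrable (fun r => potentialPart κ r (b r) (k r) (g r)) μ :=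
    (integrable_const _).mono' (aestronglyMeasurable_of_tendsto_ae atTop mp tp) bp'
  have i12 : Integrable (fun r => 4 * deriv b r ^ 2
      + gradCoeff κ r (b r) (k r) * (r * deriv k r) ^ 2) μ := i1.add i2
  have e : (fun r => 4 * deriv b r ^ 2 + gradCoeff κ r (b r) (k r) * (r * deriv k r) ^ 2
      + potentialPart κ r (b r) (k r) (g r)) =ᵐ[μ]
      fun r => calE1 κ b k r - 2 * (b r ^ 2 * g r ^ 2) :=
    hmem.mono fun r hr => (calE1_sub_eq κ b k (ne_of_gt (hK hr)) (g r)).symm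
  refine ⟨(i12.add i3).congr e, ?_⟩
  rw [← integral_congr_ae e, integral_add i12 i3, integral_add i1 i2]
  refine le_of_tendsto_of_tendsto' ((ta.add tF).add tP) hL fun n => le_trans ?_ (hl n)
  have jaf : Integrable (fun r => 4 * (2 * deriv (a n) r * deriv b r - deriv b r ^ 2)
      + gradCoeff κ r (a n r) (f n r) *
        (2 * (r * deriv (f n) r) * (r * deriv k r) - (r * deriv k r) ^ 2)) μ := (ia n).add (iF n)
  rw [← integral_add (ia n) (iF n), ← integral_add jaf (ip n)]
  have j1 := (hB n).integrableOn.mono_set hK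
  have j2 : Integrable (fun r => 2 * (a n r ^ 2 * g r ^ 2)) μ := by
    have := ma n
    refine (integrable_const (2 * (B ^ 2 * q ^ 2))).mono'
      (AEMeasurable.aestronglyMeasurable (by fun_prop)) (hmem.mono fun r hr => ?_)
    obtain ⟨hg0, hg1⟩ := hgq r (hK hr)
    rw [Real.norm_eq_abs, abs_of_nonneg (by positivity), ← sq_abs (a n r)]
    have := hab n r hr
    gcongr
  refine integral_mono_ae (jaf.add (ip n)) (j1.sub j2) (hmem.mono fun r hr => ?_)
  have h1 := calE1_sub_eq κ (a n) (f n) (ne_of_gt (hK hr)) (g r)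
  have h2 := mul_nonneg (gradCoeff_nonneg hκ r (a n r) (f n r))
    (sq_nonneg (r * deriv (f n) r - r * deriv k r))
  beta_reduce
  rw [h1]
  nlinarith [sq_nonneg (deriv (a n) r - deriv b r)]

end LowerSemicontinuity

section Minimizer

variable {κ ω q C : ℝ}

lemma calE1_sub_add_nonneg (hκ : 0 < κ) {a f g : ℝ → ℝ} {r R B : ℝ} (hr : 0 < r)
    (hB : r ≤ R → |a r| ≤ B) (hR : R < r → 2 * q ^ 2 ≤ Real.sin (f r) ^ 2)
    (hg : 0 ≤ g r ∧ g r ≤ q) :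
    0 ≤ calE1 κ a f r - 2 * (a r ^ 2 * g r ^ 2)
      + (Ioc 0 R).indicator (fun _ => 2 * (B ^ 2 * q ^ 2)) r := by
  obtain ⟨hg0, hg1⟩ := hg
  rcases le_or_gt r R with hrR | hrR
  · rw [indicator_of_mem (show r ∈ Ioc 0 R from ⟨hr, hrR⟩), ← sq_abs (a r)]
    have := hB hrR
    have : 2 * (|a r| ^ 2 * g r ^ 2) ≤ 2 * (B ^ 2 * q ^ 2) := by gcongr
    linarith [calE1_nonneg hκ a f r]
  · rw [indicator_of_notMem (fun h => absurd h.2 (not_le.2 hrR)), add_zero]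
    have h1 : 2 * (a r ^ 2 * g r ^ 2) ≤ (a r * Real.sin (f r)) ^ 2 := by
      calc 2 * (a r ^ 2 * g r ^ 2) = a r ^ 2 * (2 * g r ^ 2) := by ring
        _ ≤ a r ^ 2 * (2 * q ^ 2) := by gcongr
        _ ≤ a r ^ 2 * Real.sin (f r) ^ 2 := by gcongr; exact hR hrR
        _ = _ := by ring
    linarith [sq_mul_deriv_le_calE1 hκ a f r, sq_nonneg (r * deriv f r)]

/-- The pairs of a constrained sequence with convergent actions and bounded energies accumulate
at a pair whose constrained triple has action at most the limit. -/
lemma exists_constrained_actionL_le (hκ : 0 < κ) (hq : 0 < q)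
    (hqω : 2 * q ^ 2 < Real.sin ω ^ 2) {a f g : ℕ → ℝ → ℝ} {L : ℝ}
    (hC : ∀ n, Constrained κ ω q (a n) (f n) (g n))
    (hE : ∀ n, ∫ r in Ioi (0 : ℝ), calE1 κ (a n) (f n) r ≤ C)
    (hL : Tendsto (fun n => actionL κ (a n) (f n) (g n)) atTop (𝓝 L)) :
    ∃ b k p, Constrained κ ω q b k p ∧ actionL κ b k p ≤ L := by
  obtain ⟨c, hqc, hcω⟩ := exists_between hqω
  have hc : 0 < c := lt_trans (by positivity) hqc
  have hbe : ∀ n, BoundedEnergy κ ω C (a n) (f n) := fun n =>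
    ⟨(hC n).1.locAC_a, (hC n).1.locAC_f, (hC n).1.a_zero, (hC n).1.f_zero, (hC n).1.f_infty,
      (hC n).1.integrableOn_calE1 hκ, hE n⟩
  obtain ⟨φ, hφ, b, k, hbk⟩ := exists_energyTendsto hκ hc hcω hbe
  obtain ⟨p, hp⟩ := exists_isPotential hbk.locAC_a.1 hbk.memLp_a hq
  have hpc := hp.locAC.continuousOn_Ioi
  obtain ⟨R, hR, hRs⟩ := exists_radius_sq_sin_gt C hcω
  have hs : ∀ n r, R ≤ r → c < Real.sin (f n r) ^ 2 := fun n r hr => hRs _ <|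
    ((hbe n).sq_sub_limit_le hκ (hR.trans_le hr)).trans <| mul_le_mul_of_nonneg_right
      (inv_anti₀ hR hr) (mul_nonneg zero_le_two ((hbe n).C_nonneg hκ))
  set B := 1 + √(R * C)
  set m : ℝ → ℝ := (Ioc 0 R).indicator fun _ => 2 * (B ^ 2 * q ^ 2)
  have im : Integrable m μ₊ :=
    ((integrable_indicator_iff measurableSet_Ioc).2
      (integrableOn_const (measure_Ioc_lt_top).ne)).mono_measure Measure.restrict_le_self
  have hpD : MemLp (fun r => r * deriv p r) 2 μ₊ := memLp_mul_deriv_of_calE2 hp.integrableOn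
  set T := ∫ r in Ioi (0 : ℝ), (r * deriv p r) ^ 2
  have split : ∀ {α β : ℝ → ℝ}, IntegrableOn (calE1 κ α β) (Ioi 0) →
      MemLp (fun r => α r * p r) 2 μ₊ →
      IntegrableOn (fun r => calE1 κ α β r - 2 * (α r ^ 2 * p r ^ 2)) (Ioi 0) ∧
      ∫ r in Ioi (0 : ℝ), (calE1 κ α β r - 2 * (α r ^ 2 * p r ^ 2)) =
        (∫ r in Ioi (0 : ℝ), calE1 κ α β r) - (∫ r in Ioi (0 : ℝ), calE2 α p r) + T := by
    intro α β h1 h2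
    have i2 := integrableOn_calE2 hpD h2
    have i3 : IntegrableOn (fun r => calE1 κ α β r - calE2 α p r) (Ioi 0) := h1.sub i2
    have e : ∀ r, calE1 κ α β r - calE2 α p r + (r * deriv p r) ^ 2 =
        calE1 κ α β r - 2 * (α r ^ 2 * p r ^ 2) := fun r => by unfold calE2; ring
    refine ⟨(i3.add hpD.integrable_sq).congr (ae_of_all _ e), ?_⟩
    rw [← integral_sub h1 i2, ← integral_add i3 hpD.integrable_sq]
    exact integral_congr_ae (ae_of_all _ fun r => (e r).symm)
  have hap : ∀ {α : ℝ → ℝ}, MemLp α 2 μ₊ → MemLp (fun r => α r * p r) 2 μ₊ := fun hα => by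
    refine memLp_two_of_sq_le (hα.1.mul (hpc.aestronglyMeasurable measurableSet_Ioi))
      (hα.integrable_sq.const_mul (q ^ 2)) ?_
    filter_upwards [ae_restrict_mem measurableSet_Ioi] with r hr
    obtain ⟨h0, h1⟩ := hp.mem_Icc r hr
    rw [mul_pow, mul_comm]
    gcongr
  set F : (ℝ → ℝ) → (ℝ → ℝ) → ℝ → ℝ := fun α β r => calE1 κ α β r - 2 * (α r ^ 2 * p r ^ 2)
  have hseq : ∀ n, IntegrableOn (F (a n) (f n)) (Ioi 0) ∧
      ∫ r in Ioi (0 : ℝ), F (a n) (f n) r ≤ actionL κ (a n) (f n) (g n) + T := fun n => by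
    have h1 := hap ((hbe n).memLp_self hκ hc hR (hs n)).1
    obtain ⟨h2, h3⟩ := split (hbe n).integrableOn h1
    refine ⟨h2, h3.le.trans ?_⟩
    rw [actionL, integral_sub (hbe n).integrableOn ((hC n).1.integrableOn_calE2 hκ)]
    linarith [(hC n).integral_calE2_le hκ hp.locAC.2 hp.tendsto (integrableOn_calE2 hpD h1)]
  have hpos : ∀ n r, 0 < r → 0 ≤ F (a n) (f n) r + m r := fun n r hr =>
    calE1_sub_add_nonneg hκ hr (fun h => (hbe n).abs_apply_le hκ hr h)
      (fun h => (hqc.trans (hs n r h.le)).le) (hp.mem_Icc r hr)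
  have hposb : ∀ r, 0 < r → 0 ≤ F b k r + m r := fun r hr =>
    calE1_sub_add_nonneg hκ hr
      (fun h => le_of_tendsto (hbk.tendsto_a r hr).abs
        (Eventually.of_forall fun n => (hbe (φ n)).abs_apply_le hκ hr h))
      (fun h => ge_of_tendsto (((Real.continuous_sin.tendsto _).comp (hbk.tendsto_f r hr)).pow 2)
        (Eventually.of_forall fun n => (hqc.trans (hs (φ n) r h.le)).le)) (hp.mem_Icc r hr)
  set M := ∫ r in Ioi (0 : ℝ), m r
  have hloc : ∀ ε N : ℝ, 0 < ε → IntegrableOn (fun r => F b k r + m r) (Ioc ε N) ∧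
      ∫ r in Ioc ε N, (F b k r + m r) ≤ L + T + M := by
    intro ε N hε
    have hK : Ioc ε N ⊆ Ioi 0 := fun r hr => hε.trans hr.1
    have imK : IntegrableOn m (Ioc ε N) := IntegrableOn.mono_set im hK
    have hl : ∀ n, ∫ r in Ioc ε N, F (a (φ n)) (f (φ n)) r ≤
        actionL κ (a (φ n)) (f (φ n)) (g (φ n)) + T + M - ∫ r in Ioc ε N, m r := by
      intro n
      obtain ⟨i1, h1⟩ := hseq (φ n)
      have i2 : IntegrableOn (fun r => F (a (φ n)) (f (φ n)) r + m r) (Ioi 0) := i1.add im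
      have h2 := setIntegral_mono_set i2 ((ae_restrict_mem measurableSet_Ioi).mono
        fun r hr => hpos (φ n) r hr) (LE.le.eventuallyLE hK)
      rw [integral_add i1 im, integral_add (i1.mono_set hK) imK] at h2
      linarith
    obtain ⟨h1, h2⟩ := hbk.setIntegral_le hκ (fun n => hbe (φ n)) hpc hp.mem_Icc hε hl
      ((((hL.comp hφ.tendsto_atTop).add_const T).add_const M).sub_const _)
    refine ⟨h1.add imK, ?_⟩
    rw [integral_add h1 imK]
    linarith
  have hcover : AECover μ₊ atTop fun n : ℕ => Ioc (1 / ((n : ℝ) + 1)) n :=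
    (aecover_Ioi_of_Ioi tendsto_one_div_add_atTop_nhds_zero_nat).inter
      (aecover_Iic tendsto_natCast_atTop_atTop)
  have hε : ∀ n : ℕ, 0 < 1 / ((n : ℝ) + 1) := fun n => by positivity
  have hrestr : ∀ n : ℕ, μ₊.restrict (Ioc (1 / ((n : ℝ) + 1)) n) =
      volume.restrict (Ioc (1 / ((n : ℝ) + 1)) n) := fun n =>
    restrict_halfLine (fun r hr => (hε n).trans hr.1) measurableSet_Ioc
  have iFm : Integrable (fun r => F b k r + m r) μ₊ :=
    hcover.integrable_of_integral_bounded_of_nonneg_ae (L + T + M)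
      (fun n => by rw [IntegrableOn, hrestr n]; exact (hloc _ _ (hε n)).1)
      ((ae_restrict_mem measurableSet_Ioi).mono hposb)
      (Eventually.of_forall fun n => by rw [hrestr n]; exact (hloc _ _ (hε n)).2)
  have hFm : ∫ r in Ioi (0 : ℝ), (F b k r + m r) ≤ L + T + M :=
    le_of_tendsto (hcover.integral_tendsto_of_countably_generated iFm)
      (Eventually.of_forall fun n => by rw [hrestr n]; exact (hloc _ _ (hε n)).2)
  have iF : Integrable (F b k) μ₊ := (iFm.sub im).congr (ae_of_all _ fun r => by simp)
  rw [integral_add iF im] at hFm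
  have hbp := hap hbk.memLp_a
  have iE : IntegrableOn (calE1 κ b k) (Ioi 0) :=
    (iF.add (hbp.integrable_sq.const_mul 2)).congr (ae_of_all _ fun r => by
      simp only [F, Pi.add_apply]; ring)
  refine ⟨b, k, p, Constrained.of_isPotential hbk.locAC_a hbk.locAC_f hbk.a_zero hbk.f_zero
    hbk.a_infty hbk.f_infty iE hp, ?_⟩
  rw [actionL, integral_sub iE hp.integrableOn]
  linarith [(split iE hbp).2]

end Minimizer

/-- the infimum `η = inf { L(a,f,g) : (a,f,g) ∈ 𝒞 }` is finite and
attained, i.e. there is a minimizer of `L` over `𝒞` (so `η` is the least value). -/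
theorem infimum_attained
    (κ ω q : ℝ) (hκ : 0 < κ) (hω : ω ∈ Set.Ioo (Real.pi / 2) Real.pi)
    (hq0 : 0 < q) (hq1 : q < (Real.sqrt 2 / Real.pi) * (Real.pi - ω))
    (hq2 : q < (1 / Real.sqrt 2) * Real.sin ω) :
    ∃ a f g : ℝ → ℝ, Constrained κ ω q a f g ∧
      IsLeast {x : ℝ | ∃ a₁ f₁ g₁ : ℝ → ℝ, Constrained κ ω q a₁ f₁ g₁ ∧ actionL κ a₁ f₁ g₁ = x}
        (actionL κ a f g) := by
  have hs := sin_pos_of_mem hω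
  set d := 1 - 2 * (q / Real.sin ω) ^ 2
  have hd : 0 < d := by
    have : 2 * (q / Real.sin ω) ^ 2 < 1 := by
      rw [div_pow, ← mul_div_assoc, div_lt_one (by positivity)]
      exact two_mul_sq_lt_sq_sin hq0 hq2
    exact sub_pos.2 this
  set S := {x : ℝ | ∃ a₁ f₁ g₁ : ℝ → ℝ, Constrained κ ω q a₁ f₁ g₁ ∧ actionL κ a₁ f₁ g₁ = x}
  have hS : S.Nonempty := by
    obtain ⟨a, f, g, h⟩ := exists_constrained hκ hω hq0
    exact ⟨_, a, f, g, h, rfl⟩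
  have hS' : BddBelow S := by
    refine ⟨0, ?_⟩
    rintro _ ⟨a, f, g, h, rfl⟩
    exact (mul_nonneg hd.le (setIntegral_nonneg measurableSet_Ioi
      fun r _ => calE1_nonneg hκ a f r)).trans (h.le_actionL hκ hω)
  obtain ⟨u, hu, hlim, hmem⟩ := exists_seq_tendsto_sInf hS hS'
  choose a f g hC hua using hmem
  obtain ⟨b, k, p, hc, hle⟩ := exists_constrained_actionL_le (C := u 0 / d) hκ hq0
    (two_mul_sq_lt_sq_sin hq0 hq2) hC
    (fun n => by
      rw [le_div_iff₀' hd]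
      exact ((hC n).le_actionL hκ hω).trans ((hua n).le.trans (hu n.zero_le)))
    (L := sInf S) (by simpa only [hua] using hlim)
  exact ⟨b, k, p, hc, ⟨b, k, p, hc, rfl⟩, fun x hx => hle.trans (csInf_le hS' hx)⟩
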